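/- arXiv:1403.0372 — 2 statements merged into one kernel-verified Lean document; each statement's English description precedes it below -/
import Mathlib

section
/- Suppose 1<p<q<∞ and 0<α<1, and let v, w be weight functions on ℝ. Then the one-sided fractional maximal operator M⁺_α is bounded from L^p_w(ℝ) to L^q_v(ℝ) if and only if A^+_{GK}(v,w,p,q) = sup_{a∈ℝ, h>0} (∫_{a-h}^{a+h} w^{1-p'})^{1/p'} (∫_{-∞}^{a-h} v(y)(a-y)^{-(1-α)q} dy)^{1/q} < ∞; moreover the operator norm ‖M⁺_α‖_{L^p_w→L^q_v} is comparable to A^+_{GK}(v,w,p,q) with comparability constants depending only on p, q, α. -/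
open MeasureTheory Set Filter
open scoped ENNReal

noncomputable section

/-- A weight on `ℝ`: an a.e. positive, locally integrable function. -/
def IsWeight (w : ℝ → ℝ) : Prop :=
  (∀ᵐ x : ℝ, 0 < w x) ∧ MeasureTheory.LocallyIntegrable w MeasureTheory.volume

/-- Weighted `L^p` "norm" `(∫ g^p w)^{1/p}` of an `ℝ≥0∞`-valued function. -/
def lnormW (p : ℝ) (w : ℝ → ℝ) (g : ℝ → ℝ≥0∞) : ℝ≥0∞ :=
  (∫⁻ x : ℝ, g x ^ p * ENNReal.ofReal (w x)) ^ (1 / p)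

/-- One-sided fractional maximal operator
`M⁺_α f(x) = sup_{h>0} h^{α-1} ∫_x^{x+h} |f|`. -/
def MplusAlpha (α : ℝ) (f : ℝ → ℝ) (x : ℝ) : ℝ≥0∞ :=
  ⨆ (h : ℝ) (_ : 0 < h),
    ENNReal.ofReal (h ^ (α - 1)) * ∫⁻ t in Set.Ioc x (x + h), ENNReal.ofReal |f t|

/-- The Gabidzashvili–Kokilashvili two-weight quantity
`A⁺_{GK}(v,w,p,q) = sup_{a,h>0} (∫_{a-h}^{a+h} w^{1-p'})^{1/p'}
  (∫_{-∞}^{a-h} v(y)(a-y)^{-(1-α)q} dy)^{1/q}`, with `p' = p/(p-1)`. -/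
def AGKplus (α p q : ℝ) (v w : ℝ → ℝ) : ℝ≥0∞ :=
  ⨆ (a : ℝ) (h : ℝ) (_ : 0 < h),
    (∫⁻ t in Set.Ioc (a - h) (a + h),
        ENNReal.ofReal (w t ^ (1 - p / (p - 1)))) ^ (1 - 1 / p) *
      (∫⁻ y in Set.Iio (a - h),
          ENNReal.ofReal (v y * (a - y) ^ (-(1 - α) * q))) ^ (1 / q)

/-- level function -/
def Glev (p q : ℝ) (k : ℤ) (y : ℝ≥0∞) : ℝ≥0∞ :=
  if y ≤ (2:ℝ≥0∞) ^ (-(k:ℝ) / p) then (2:ℝ≥0∞) ^ ((k:ℝ) * (q - 1)) * y ^ q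
  else (2:ℝ≥0∞) ^ ((k:ℝ) * (q - 1) * (1 - 1 / p)) * y

def gser (p q : ℝ) (m : ℤ) : ℝ≥0∞ :=
  if m ≤ 0 then (2:ℝ≥0∞) ^ ((m:ℝ) * (q / p - 1)) else (2:ℝ≥0∞) ^ (-((m:ℝ) - 1) * (1 - 1 / p))

lemma geo_ne_top (a : ℝ) (ha : 0 < a) : ∑' n : ℕ, (2:ℝ≥0∞) ^ (-(n:ℝ) * a) ≠ ∞ := by
  have h : ∀ n : ℕ, (2:ℝ≥0∞) ^ (-(n:ℝ) * a) = ((2:ℝ≥0∞) ^ (-a)) ^ n := by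
    intro n
    rw [← ENNReal.rpow_natCast, ← ENNReal.rpow_mul]; congr 1; ring
  simp_rw [h]
  rw [ENNReal.tsum_geometric]
  apply ENNReal.inv_ne_top.2
  have : (2:ℝ≥0∞) ^ (-a) < 1 := ENNReal.rpow_lt_one_of_one_lt_of_neg (by norm_num) (by linarith)
  exact (tsub_pos_of_lt this).ne'

lemma gser_ne_top (p q : ℝ) (hp : 1 < p) (hpq : p < q) : ∑' m : ℤ, gser p q m ≠ ∞ := by
  have h0 : 0 < q / p - 1 := by rw [sub_pos, lt_div_iff₀ (by linarith)]; linarith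
  have h1 : 0 < 1 - 1 / p := by rw [sub_pos, div_lt_iff₀ (by linarith)]; linarith
  rw [tsum_of_nat_of_neg_add_one ENNReal.summable ENNReal.summable]
  apply ENNReal.add_ne_top.2 ⟨?_, ?_⟩
  · rw [tsum_eq_zero_add' ENNReal.summable]
    apply ENNReal.add_ne_top.2 ⟨by simp [gser], ?_⟩
    refine ne_top_of_le_ne_top (geo_ne_top _ h1) (ENNReal.tsum_le_tsum fun n => ?_)
    rw [gser, if_neg (by push_cast; omega)]
    push_cast; simp
  · refine ne_top_of_le_ne_top (geo_ne_top _ h0) (ENNReal.tsum_le_tsum fun n => ?_)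
    rw [gser, if_pos (by omega)]
    push_cast
    apply ENNReal.rpow_le_rpow_of_exponent_le (by norm_num)
    nlinarith

lemma two_pow_inj {a b : ℝ} (h : a = b) : (2:ℝ≥0∞) ^ a = (2:ℝ≥0∞) ^ b := by rw [h]

lemma two_add (a b : ℝ) : (2:ℝ≥0∞) ^ a * (2:ℝ≥0∞) ^ b = (2:ℝ≥0∞) ^ (a + b) :=
  (ENNReal.rpow_add _ _ (by norm_num) (by norm_num)).symm

lemma exists_level (z : ℝ≥0∞) (h0 : z ≠ 0) (h1 : z ≠ ∞) :
    ∃ K : ℤ, (2:ℝ≥0∞) ^ (K:ℝ) < z ∧ z ≤ (2:ℝ≥0∞) ^ ((K:ℝ) + 1) := by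
  obtain ⟨K, hK⟩ := ENNReal.exists_mem_Ioc_zpow h0 h1 (y := 2) (by norm_num) (by norm_num)
  refine ⟨K, ?_, ?_⟩
  · rw [ENNReal.rpow_intCast]; exact hK.1
  · have := hK.2
    rw [← ENNReal.rpow_intCast] at this
    simpa using this

lemma level_sum (p q : ℝ) (hp : 1 < p) (hpq : p < q) (y : ℝ≥0∞) :
    ∑' k : ℤ, (2:ℝ≥0∞) ^ (-(k:ℝ) * (q * (1 - 1 / p))) * Glev p q k y
      ≤ 2 ^ q * (∑' m : ℤ, gser p q m) * y ^ p := by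
  have hp0 : 0 < p := by linarith
  have h0 : 0 < q / p - 1 := by rw [sub_pos, lt_div_iff₀ (by linarith)]; linarith
  have h1 : 0 < 1 - 1 / p := by rw [sub_pos, div_lt_iff₀ (by linarith)]; linarith
  rcases eq_or_ne y 0 with rfl | hy0
  · have : ∀ k : ℤ, Glev p q k 0 = 0 := by
      intro k; simp [Glev, ENNReal.zero_rpow_of_pos (show 0 < q by linarith)]
    simp [this]
  rcases eq_or_ne y ∞ with rfl | hyt
  · have : (∑' m : ℤ, gser p q m) ≠ 0 := by
      intro h
      have := ENNReal.tsum_eq_zero.1 h 0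
      simp [gser] at this
    rw [ENNReal.top_rpow_of_pos hp0, ENNReal.mul_top]
    · exact le_top
    · exact mul_ne_zero (by simp) this
  -- `2^K < y^{-p} ≤ 2^(K+1)`
  obtain ⟨K, hK1, hK2⟩ := exists_level (y ^ (-p)) (by simp [hy0, hyt, ENNReal.rpow_eq_zero_iff])
    (by simp [hy0, hyt, ENNReal.rpow_eq_top_iff])
  have ymul : ∀ a b : ℝ, y ^ a * y ^ b = y ^ (a + b) := fun a b =>
    (ENNReal.rpow_add a b hy0 hyt).symm
  rw [← (Equiv.addLeft K).tsum_eq, mul_assoc, ← ENNReal.tsum_mul_right, ← ENNReal.tsum_mul_left]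
  refine ENNReal.tsum_le_tsum fun m => ?_
  simp only [Equiv.coe_addLeft]
  have e1 : ∀ s : ℝ, 0 < s → (2:ℝ≥0∞) ^ ((K:ℝ) * s) ≤ y ^ (-p * s) := by
    intro s hs
    rw [ENNReal.rpow_mul, ENNReal.rpow_mul]
    exact ENNReal.rpow_le_rpow hK1.le hs.le
  have e2 : ∀ s : ℝ, 0 < s → (2:ℝ≥0∞) ^ (-((K:ℝ) + 1) * s) ≤ y ^ (p * s) := by
    intro s hs
    have := ENNReal.rpow_le_rpow hK2 hs.le
    rw [← ENNReal.rpow_mul, ← ENNReal.rpow_mul] at this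
    rw [neg_mul, ENNReal.rpow_neg, show p * s = - (-p * s) by ring, ENNReal.rpow_neg]
    exact ENNReal.inv_le_inv.2 this
  rw [Glev]
  have hpinv : p * p⁻¹ = 1 := mul_inv_cancel₀ hp0.ne'
  split_ifs with hc
  · -- low
    have key : (2:ℝ≥0∞) ^ (-((K + m : ℤ):ℝ) * (q * (1 - 1 / p))) *
        ((2:ℝ≥0∞) ^ (((K + m : ℤ):ℝ) * (q - 1)) * y ^ q) ≤ 2 ^ ((m:ℝ) * (q / p - 1)) * y ^ p := by
      rw [← mul_assoc, two_add]
      have : (2:ℝ≥0∞) ^ (-((K + m : ℤ):ℝ) * (q * (1 - 1 / p)) + ((K + m : ℤ):ℝ) * (q - 1)) =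
         2 ^ ((m:ℝ) * (q / p - 1)) * 2 ^ ((K:ℝ) * (q / p - 1)) := by
        rw [two_add]; apply two_pow_inj; push_cast; ring
      rw [this, mul_assoc]
      refine mul_le_mul_right ?_ _
      refine (mul_le_mul_left (e1 _ h0) _).trans ?_
      rw [ymul]
      apply le_of_eq; congr 1; field_simp; ring
    refine key.trans ?_
    rw [← mul_assoc]
    refine mul_le_mul_left ?_ _
    -- m ≤ 1
    have hm : m ≤ 1 := by
      by_contra hm
      push Not at hm
      have h3 : (2:ℝ≥0∞) ^ (((K + m : ℤ):ℝ)) ≤ y ^ (-p) := by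
        rw [ENNReal.rpow_neg]
        rw [ENNReal.le_inv_iff_le_inv, ← ENNReal.rpow_neg]
        have := ENNReal.rpow_le_rpow hc hp0.le
        rw [← ENNReal.rpow_mul] at this
        rwa [div_mul_cancel₀ _ hp0.ne'] at this
      have h4 : (2:ℝ≥0∞) ^ ((K:ℝ) + 1) < (2:ℝ≥0∞) ^ (((K + m : ℤ):ℝ)) := by
        apply ENNReal.rpow_lt_rpow_of_exponent_lt (by norm_num) (by norm_num)
        have : (1:ℝ) < m := by exact_mod_cast hm
        push_cast; linarith
      exact absurd (h3.trans hK2) (not_le.2 h4)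
    rcases hm.lt_or_eq with hm | rfl
    · rw [gser, if_pos (by omega)]
      exact le_mul_of_one_le_left zero_le (ENNReal.one_le_rpow (by norm_num) (by linarith))
    · rw [gser, if_neg (by norm_num)]
      simp only [Int.cast_one, sub_self, neg_zero, zero_mul, ENNReal.rpow_zero, mul_one]
      apply ENNReal.rpow_le_rpow_of_exponent_le (by norm_num)
      have : q / p ≤ q := div_le_self (by linarith) hp.le
      linarith
  · push Not at hc
    have hm : 0 < m := by
      by_contra hm
      push Not at hm
      have h3 : y ^ (-p) ≤ (2:ℝ≥0∞) ^ (((K + m : ℤ):ℝ)) := by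
        rw [ENNReal.rpow_neg, ENNReal.inv_le_iff_inv_le, ← ENNReal.rpow_neg]
        have := ENNReal.rpow_le_rpow hc.le hp0.le
        rw [← ENNReal.rpow_mul] at this
        rwa [div_mul_cancel₀ _ hp0.ne'] at this
      have h4 : (2:ℝ≥0∞) ^ (((K + m : ℤ):ℝ)) ≤ (2:ℝ≥0∞) ^ (K:ℝ) := by
        apply ENNReal.rpow_le_rpow_of_exponent_le (by norm_num)
        have : (m:ℝ) ≤ 0 := by exact_mod_cast hm
        push_cast; linarith
      exact absurd (h3.trans h4) (not_le.2 hK1)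
    have key : (2:ℝ≥0∞) ^ (-((K + m : ℤ):ℝ) * (q * (1 - 1 / p))) *
        ((2:ℝ≥0∞) ^ (((K + m : ℤ):ℝ) * (q - 1) * (1 - 1 / p)) * y) ≤
        2 ^ (-((m:ℝ) - 1) * (1 - 1 / p)) * y ^ p := by
      rw [← mul_assoc, two_add]
      have : (2:ℝ≥0∞) ^ (-((K + m : ℤ):ℝ) * (q * (1 - 1 / p)) +
          ((K + m : ℤ):ℝ) * (q - 1) * (1 - 1 / p)) =
         2 ^ (-((m:ℝ) - 1) * (1 - 1 / p)) * 2 ^ (-((K:ℝ) + 1) * (1 - 1 / p)) := by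
        rw [two_add]; apply two_pow_inj; push_cast; ring
      rw [this, mul_assoc]
      refine mul_le_mul_right ?_ _
      refine (mul_le_mul_left (e2 _ h1) _).trans ?_
      nth_rewrite 2 [← ENNReal.rpow_one y]
      rw [ymul]
      apply le_of_eq; congr 1; field_simp; ring
    refine key.trans ?_
    rw [← mul_assoc]
    refine mul_le_mul_left ?_ _
    rw [gser, if_neg (by omega)]
    exact le_mul_of_one_le_left zero_le (ENNReal.one_le_rpow (by norm_num) (by linarith))

lemma Glev_meas (p q : ℝ) (k : ℤ) : Measurable (Glev p q k) := by
  unfold Glev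
  refine Measurable.ite measurableSet_Iic ?_ ?_ <;> fun_prop

lemma jensen_set {q : ℝ} (hq : 1 < q) (μ : Measure ℝ) (I : Set ℝ) (f : ℝ → ℝ≥0∞)
    (hf : Measurable f) :
    (∫⁻ t in I, f t ∂μ) ^ q ≤ μ I ^ (q - 1) * ∫⁻ t in I, f t ^ q ∂μ := by
  have hc : q.HolderConjugate (Real.conjExponent q) := Real.HolderConjugate.conjExponent hq
  have := ENNReal.lintegral_mul_le_Lp_mul_Lq (μ.restrict I) hc (f := f) (g := fun _ => 1)
    hf.aemeasurable aemeasurable_const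
  simp only [Pi.mul_apply, mul_one, ENNReal.one_rpow, lintegral_const, one_mul,
    Measure.restrict_apply MeasurableSet.univ, univ_inter] at this
  have h2 := ENNReal.rpow_le_rpow this (show 0 ≤ q by linarith)
  refine h2.trans ?_
  rw [ENNReal.mul_rpow_of_nonneg _ _ (by linarith), ← ENNReal.rpow_mul, ← ENNReal.rpow_mul,
    mul_comm]
  apply le_of_eq
  congr 1
  · congr 1
    unfold Real.conjExponent
    have : q - 1 ≠ 0 := by linarith
    field_simp
  · rw [one_div, inv_mul_cancel₀ (by linarith), ENNReal.rpow_one]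

lemma level_set {p q : ℝ} (hp : 1 < p) (hpq : p < q) (μ : Measure ℝ) (I : Set ℝ)
    (k : ℤ) (hI : μ I ≤ (2:ℝ≥0∞) ^ ((k:ℝ) + 1)) (f : ℝ → ℝ≥0∞)
    (hf : Measurable f) (hf1 : ∫⁻ t, f t ^ p ∂μ ≤ 1) :
    (∫⁻ t in I, f t ∂μ) ^ q ≤ 2 ^ (q - 1) * 2 ^ (q - 1) * ∫⁻ t in I, Glev p q k (f t) ∂μ := by
  have hp0 : 0 < p := by linarith
  have hq : 1 < q := by linarith
  set T : ℝ≥0∞ := (2:ℝ≥0∞) ^ (-(k:ℝ) / p) with hT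
  have hT0 : T ≠ 0 := by simp [hT, ENNReal.rpow_eq_zero_iff]
  have hTt : T ≠ ∞ := by simp [hT, ENNReal.rpow_eq_top_iff]
  set lo : ℝ → ℝ≥0∞ := fun t => if f t ≤ T then f t else 0 with hlo
  set hi : ℝ → ℝ≥0∞ := fun t => if f t ≤ T then 0 else f t with hhi
  have mS : MeasurableSet {t | f t ≤ T} := hf measurableSet_Iic
  have mlo : Measurable lo := Measurable.ite mS hf measurable_const
  have mhi : Measurable hi := Measurable.ite mS measurable_const hf
  have hsum : ∀ t, f t = lo t + hi t := by
    intro t; simp only [hlo, hhi]; split_ifs <;> simp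
  have hG : ∀ t, Glev p q k (f t) = (2:ℝ≥0∞) ^ ((k:ℝ) * (q - 1)) * lo t ^ q +
      (2:ℝ≥0∞) ^ ((k:ℝ) * (q - 1) * (1 - 1 / p)) * hi t := by
    intro t; simp only [hlo, hhi, Glev]; split_ifs
    · simp
    · simp [ENNReal.zero_rpow_of_pos (show 0 < q by linarith)]
  simp_rw [hG]
  rw [lintegral_add_right _ (by fun_prop), lintegral_const_mul _ (by fun_prop),
    lintegral_const_mul _ (by fun_prop)]
  simp_rw [hsum]
  rw [lintegral_add_right _ (by fun_prop)]
  refine (ENNReal.rpow_add_le_mul_rpow_add_rpow _ _ hq.le).trans ?_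
  rw [mul_assoc]
  refine mul_le_mul_right ?_ _
  rw [mul_add]
  refine add_le_add ?_ ?_
  · refine (jensen_set hq μ I lo mlo).trans ?_
    rw [← mul_assoc]
    refine mul_le_mul_left ?_ _
    refine (ENNReal.rpow_le_rpow hI (by linarith)).trans ?_
    rw [two_add, ← ENNReal.rpow_mul]
    apply le_of_eq; apply two_pow_inj; ring
  · have hb : ∫⁻ t in I, hi t ∂μ ≤ (2:ℝ≥0∞) ^ ((k:ℝ) * (1 - 1 / p)) := by
      calc ∫⁻ t in I, hi t ∂μ ≤ ∫⁻ t, hi t ∂μ := setLIntegral_le_lintegral _ _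
        _ ≤ ∫⁻ t, T ^ (1 - p) * f t ^ p ∂μ := by
          refine lintegral_mono fun t => ?_
          simp only [hhi]
          split_ifs with h
          · exact zero_le
          · push Not at h
            have h1 : T ^ (p - 1) ≤ f t ^ (p - 1) := ENNReal.rpow_le_rpow h.le (by linarith)
            have h0 : f t ≠ 0 := (lt_of_le_of_lt zero_le h).ne'
            calc f t = T ^ (1 - p) * (T ^ (p - 1) * f t) := by
                  rw [← mul_assoc, ← ENNReal.rpow_add _ _ hT0 hTt]; simp
              _ ≤ T ^ (1 - p) * (f t ^ (p - 1) * f t) := by gcongr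
              _ = T ^ (1 - p) * f t ^ p := by
                  congr 1
                  nth_rewrite 2 [← ENNReal.rpow_one (f t)]
                  rw [← ENNReal.rpow_add_of_nonneg _ _ (by linarith) (by linarith)]
                  simp
        _ = T ^ (1 - p) * ∫⁻ t, f t ^ p ∂μ := lintegral_const_mul _ (by fun_prop)
        _ ≤ T ^ (1 - p) * 1 := by gcongr
        _ = _ := by
          rw [mul_one, hT, ← ENNReal.rpow_mul]; apply two_pow_inj; field_simp; ring
    calc (∫⁻ t in I, hi t ∂μ) ^ q = (∫⁻ t in I, hi t ∂μ) ^ (q - 1) * (∫⁻ t in I, hi t ∂μ) := by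
          nth_rewrite 3 [← ENNReal.rpow_one (∫⁻ t in I, hi t ∂μ)]
          rw [← ENNReal.rpow_add_of_nonneg _ _ (by linarith) (by linarith)]
          simp
      _ ≤ ((2:ℝ≥0∞) ^ ((k:ℝ) * (1 - 1 / p))) ^ (q - 1) * (∫⁻ t in I, hi t ∂μ) := by
          gcongr
      _ = (2:ℝ≥0∞) ^ ((k:ℝ) * (q - 1) * (1 - 1 / p)) * (∫⁻ t in I, hi t ∂μ) := by
          rw [← ENNReal.rpow_mul]; congr 1; apply two_pow_inj; ring
      _ ≤ _ := by
          exact le_mul_of_one_le_left zero_le (ENNReal.one_le_rpow (by norm_num) (by linarith))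

def Phi (μ : Measure ℝ) (t : ℝ) : ℝ := ∫ _x in (0:ℝ)..t, (1:ℝ) ∂μ

lemma one_ii (μ : Measure ℝ) (hfin : ∀ a b, μ (Ioc a b) < ∞) (a b : ℝ) :
    IntervalIntegrable (fun _ => (1:ℝ)) μ a b := by
  constructor
  · exact integrableOn_const (hfin _ _).ne
  · exact integrableOn_const (hfin _ _).ne

lemma Phi_sub (μ : Measure ℝ) (hfin : ∀ a b, μ (Ioc a b) < ∞) {c d : ℝ} (h : c ≤ d) :
    Phi μ d - Phi μ c = (μ (Ioc c d)).toReal := by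
  unfold Phi
  rw [intervalIntegral.integral_interval_sub_left (one_ii μ hfin _ _) (one_ii μ hfin _ _),
    intervalIntegral.integral_of_le h]
  simp [Measure.real]

lemma Phi_cont (μ : Measure ℝ) [NullSingletonClass μ] (hfin : ∀ a b, μ (Ioc a b) < ∞) :
    Continuous (Phi μ) :=
  intervalIntegral.continuous_primitive (one_ii μ hfin) 0

lemma Phi_mono (μ : Measure ℝ) (hfin : ∀ a b, μ (Ioc a b) < ∞)
    (hpos : ∀ a b, a < b → 0 < μ (Ioc a b)) : StrictMono (Phi μ) := by
  intro a b hab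
  have := Phi_sub μ hfin hab.le
  have h2 := ENNReal.toReal_pos (hpos a b hab).ne' (hfin a b).ne
  linarith

def spt (μ : Measure ℝ) (k i : ℤ) : ℝ := Function.invFun (Phi μ) (i * (2:ℝ) ^ k)

def Pset (μ : Measure ℝ) (k i : ℤ) : Set ℝ := {t | |Phi μ t - i * (2:ℝ) ^ k| < 2 * (2:ℝ) ^ k}

def Xset (μ : Measure ℝ) (k : ℤ) (s : ℝ) : Set ℝ :=
  ⋃ η : {η : ℚ // 0 < η ∧ (2:ℝ≥0∞) ^ (k:ℝ) < μ (Ioc (s - η) (s + η))}, Iio (s - (η.1 : ℝ))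

lemma X_meas (μ : Measure ℝ) (k : ℤ) (s : ℝ) : MeasurableSet (Xset μ k s) :=
  MeasurableSet.iUnion fun _ => measurableSet_Iio

lemma X_bound (μ : Measure ℝ) (A : ℝ≥0∞) (e : ℝ) (he : 0 < e) (k : ℤ) (s : ℝ)
    (ν : Measure ℝ) (g : ℝ → ℝ≥0∞)
    (hA : ∀ η : ℝ, 0 < η → μ (Ioc (s - η) (s + η)) ^ e * ∫⁻ y in Iio (s - η), g y ∂ν ≤ A) :
    ∫⁻ y in Xset μ k s, g y ∂ν ≤ A * (2:ℝ≥0∞) ^ (-(k:ℝ) * e) := by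
  unfold Xset
  rw [setLIntegral_iUnion_of_directed]
  · refine iSup_le ?_
    rintro ⟨η, hη, hμ⟩
    have h1 := hA η (by exact_mod_cast hη)
    have h2 : ((2:ℝ≥0∞) ^ (k:ℝ)) ^ e ≤ μ (Ioc (s - η) (s + η)) ^ e :=
      ENNReal.rpow_le_rpow hμ.le he.le
    have h3 := (mul_le_mul_left h2 (∫⁻ y in Iio (s - η), g y ∂ν)).trans h1
    rw [← ENNReal.rpow_mul] at h3
    calc ∫⁻ y in Iio (s - η), g y ∂ν
        = ((2:ℝ≥0∞) ^ ((k:ℝ) * e) * ∫⁻ y in Iio (s - η), g y ∂ν) * (2:ℝ≥0∞) ^ (-(k:ℝ) * e) := by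
          rw [mul_comm, ← mul_assoc, two_add]
          simp
      _ ≤ _ := mul_le_mul_left h3 _
  · intro a b
    rcases le_total a.1 b.1 with h | h
    · refine ⟨a, subset_rfl, Iio_subset_Iio ?_⟩
      have : (a.1:ℝ) ≤ b.1 := by exact_mod_cast h
      linarith
    · refine ⟨b, Iio_subset_Iio ?_, subset_rfl⟩
      have : (b.1:ℝ) ≤ a.1 := by exact_mod_cast h
      linarith

lemma P_meas (μ : Measure ℝ) [NullSingletonClass μ] (hfin : ∀ a b, μ (Ioc a b) < ∞) (k i : ℤ) :
    MeasurableSet (Pset μ k i) := by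
  have := Phi_cont μ hfin
  exact (isOpen_lt (by fun_prop) (by fun_prop)).measurableSet

lemma P_sum (μ : Measure ℝ) [NullSingletonClass μ] (hfin : ∀ a b, μ (Ioc a b) < ∞) (k : ℤ)
    (g : ℝ → ℝ≥0∞) (hg : Measurable g) :
    ∑' i : ℤ, ∫⁻ t in Pset μ k i, g t ∂μ ≤ 5 * ∫⁻ t, g t ∂μ := by
  simp_rw [← lintegral_indicator (P_meas μ hfin k _)]
  rw [← lintegral_tsum (fun i => (hg.indicator (P_meas μ hfin k i)).aemeasurable),
    ← lintegral_const_mul _ hg]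
  refine lintegral_mono fun t => ?_
  set u := ⌊Phi μ t / (2:ℝ) ^ k⌋ with hu
  have h2 : (0:ℝ) < (2:ℝ) ^ k := by positivity
  rw [tsum_eq_sum (s := Finset.Icc (u - 2) (u + 2))]
  · refine (Finset.sum_le_card_nsmul _ _ (g t) (fun i _ => indicator_le_self _ _ _)).trans ?_
    simp
    have : (u + 2 + 1 - (u - 2)).toNat = 5 := by omega
    rw [this]; norm_num
  · intro i hi
    refine indicator_of_notMem ?_ _
    intro hmem
    apply hi
    simp only [Pset, mem_ofPred_eq] at hmem
    have h3 : |Phi μ t / (2:ℝ) ^ k - i| < 2 := by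
      rw [← mul_lt_mul_iff_left₀ h2]
      rw [← abs_of_pos h2, ← abs_mul, abs_of_pos h2, sub_mul, div_mul_cancel₀ _ h2.ne']
      exact hmem
    rw [abs_lt] at h3
    have h4 := Int.floor_le (Phi μ t / (2:ℝ) ^ k)
    have h5 := Int.lt_floor_add_one (Phi μ t / (2:ℝ) ^ k)
    rw [← hu] at h4 h5
    have h6 : (u:ℝ) - 2 < i := by linarith
    have h7 : (i:ℝ) < u + 3 := by linarith
    have h6' : u - 2 < i := by exact_mod_cast h6
    have h7' : i < u + 3 := by exact_mod_cast h7
    rw [Finset.mem_Icc]; omega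

def Rfun (p q γ : ℝ) (μ : Measure ℝ) (f : ℝ → ℝ≥0∞) (x : ℝ) : ℝ≥0∞ :=
  ∑' (k : ℤ) (i : ℤ), (∫⁻ t in Pset μ k i, Glev p q k (f t) ∂μ) *
    (Xset μ k (spt μ k i)).indicator
      (fun y => ENNReal.ofReal ((spt μ k i - y) ^ (-γ * q))) x

lemma key_pt {p q γ : ℝ} (hp : 1 < p) (hpq : p < q) (hγ : 0 < γ) (μ : Measure ℝ) [NullSingletonClass μ]
    (hfin : ∀ a b, μ (Ioc a b) < ∞)
    (hpos : ∀ a b, a < b → 0 < μ (Ioc a b)) (f : ℝ → ℝ≥0∞)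
    (hf : Measurable f) (hf1 : ∫⁻ t, f t ^ p ∂μ ≤ 1) (x h : ℝ) (hh : 0 < h) :
    ENNReal.ofReal (h ^ (-γ * q)) * (∫⁻ t in Ioc (x + h / 2) (x + h), f t ∂μ) ^ q ≤
      2 ^ (q - 1) * 2 ^ (q - 1) * Rfun p q γ μ f x := by
  set c := x + h / 2 with hc
  set d := x + h with hd
  have hcd : c < d := by linarith
  obtain ⟨k, hk1, hk2⟩ := exists_level (μ (Ioc c d)) (hpos c d hcd).ne' (hfin c d).ne
  have h2 : (0:ℝ) < (2:ℝ) ^ k := by positivity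
  have hsub := Phi_sub μ hfin hcd.le
  have e2 : ((2:ℝ≥0∞) ^ (k:ℝ)).toReal = (2:ℝ) ^ k := by
    rw [← ENNReal.toReal_rpow]; simp
  have e3 : ((2:ℝ≥0∞) ^ ((k:ℝ) + 1)).toReal = 2 * (2:ℝ) ^ k := by
    rw [← ENNReal.toReal_rpow, Real.rpow_add (by simp)]; simp [mul_comm]
  have r1 : (2:ℝ) ^ k < Phi μ d - Phi μ c := by
    rw [hsub, ← e2]
    exact (ENNReal.toReal_lt_toReal (ne_top_of_lt hk1) (hfin c d).ne).2 hk1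
  have r2 : Phi μ d - Phi μ c ≤ 2 * (2:ℝ) ^ k := by
    rw [hsub, ← e3]
    exact (ENNReal.toReal_le_toReal (hfin c d).ne (by simp [ENNReal.rpow_eq_top_iff])).2 hk2
  set i := ⌊Phi μ d / (2:ℝ) ^ k⌋ with hi
  have i1 : i * (2:ℝ) ^ k ≤ Phi μ d := by
    rw [← le_div_iff₀ h2]; exact Int.floor_le _
  have i2 : Phi μ d < (i + 1) * (2:ℝ) ^ k := by
    rw [← div_lt_iff₀ h2]; exact Int.lt_floor_add_one _
  obtain ⟨s, ⟨hs1, hs2⟩, hs3⟩ : ∃ s ∈ Icc c d, Phi μ s = i * (2:ℝ) ^ k := by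
    apply intermediate_value_Icc hcd.le (Phi_cont μ hfin).continuousOn
    constructor <;> nlinarith
  have mono := Phi_mono μ hfin hpos
  have hs1' : c < s := by
    rw [← mono.lt_iff_lt, hs3]; nlinarith
  have hspt : spt μ k i = s := by
    unfold spt
    rw [← hs3]
    exact Function.leftInverse_invFun mono.injective s
  have hIP : Ioc c d ⊆ Pset μ k i := by
    intro t ht
    have t1 := mono ht.1
    have t2 := mono.monotone ht.2
    simp only [Pset, mem_ofPred_eq, abs_lt]
    have := mono hs1'
    constructor <;> nlinarith
  have hX : x ∈ Xset μ k s := by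
    obtain ⟨η, hη1, hη2⟩ := exists_rat_btwn (show h / 2 < s - x by linarith)
    refine mem_iUnion.2 ⟨⟨η, ?_, ?_⟩, ?_⟩
    · have : (0:ℝ) < η := by linarith
      exact_mod_cast this
    · refine hk1.trans_le (measure_mono (Ioc_subset_Ioc ?_ ?_)) <;> linarith
    · show x < s - η
      linarith
  have hle := level_set hp hpq μ (Ioc c d) k hk2 f hf hf1
  calc ENNReal.ofReal (h ^ (-γ * q)) * (∫⁻ t in Ioc c d, f t ∂μ) ^ q
      ≤ ENNReal.ofReal ((s - x) ^ (-γ * q)) *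
        (2 ^ (q - 1) * 2 ^ (q - 1) * ∫⁻ t in Pset μ k i, Glev p q k (f t) ∂μ) := by
        refine mul_le_mul' (ENNReal.ofReal_le_ofReal ?_) (hle.trans ?_)
        · apply Real.rpow_le_rpow_of_nonpos (by linarith) (by linarith)
          nlinarith
        · exact mul_le_mul_right (lintegral_mono_set hIP) _
    _ = 2 ^ (q - 1) * 2 ^ (q - 1) * ((∫⁻ t in Pset μ k i, Glev p q k (f t) ∂μ) *
      (Xset μ k (spt μ k i)).indicator
      (fun y => ENNReal.ofReal ((spt μ k i - y) ^ (-γ * q))) x) := by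
        rw [hspt, indicator_of_mem hX]; ring
    _ ≤ _ := by
        refine mul_le_mul_right ?_ _
        unfold Rfun
        exact (ENNReal.le_tsum (f := fun i : ℤ => (∫⁻ t in Pset μ k i, Glev p q k (f t) ∂μ) *
          (Xset μ k (spt μ k i)).indicator
          (fun y => ENNReal.ofReal ((spt μ k i - y) ^ (-γ * q))) x) i).trans
          (ENNReal.le_tsum (f := fun k : ℤ => ∑' i : ℤ, (∫⁻ t in Pset μ k i, Glev p q k (f t) ∂μ) *
          (Xset μ k (spt μ k i)).indicator
          (fun y => ENNReal.ofReal ((spt μ k i - y) ^ (-γ * q))) x) k)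

lemma R_meas (p q γ : ℝ) (μ : Measure ℝ) (f : ℝ → ℝ≥0∞) : Measurable (Rfun p q γ μ f) := by
  unfold Rfun
  refine Measurable.tsum fun k => Measurable.tsum fun i => ?_
  refine Measurable.const_mul (Measurable.indicator ?_ (X_meas _ _ _)) _
  fun_prop

lemma R_int {p q γ : ℝ} (hp : 1 < p) (hpq : p < q) (μ ν : Measure ℝ) [NullSingletonClass μ]
    (hfin : ∀ a b, μ (Ioc a b) < ∞) (f : ℝ → ℝ≥0∞)
    (hf : Measurable f) (hf1 : ∫⁻ t, f t ^ p ∂μ ≤ 1) (A : ℝ≥0∞)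
    (hA : ∀ s η : ℝ, 0 < η → μ (Ioc (s - η) (s + η)) ^ (q * (1 - 1 / p)) *
      ∫⁻ y in Iio (s - η), ENNReal.ofReal ((s - y) ^ (-γ * q)) ∂ν ≤ A) :
    ∫⁻ x, Rfun p q γ μ f x ∂ν ≤ A * (5 * (2 ^ q * (∑' m : ℤ, gser p q m))) := by
  have h1 : 0 < 1 - 1 / p := by rw [sub_pos, div_lt_iff₀ (by linarith)]; linarith
  have he : 0 < q * (1 - 1 / p) := mul_pos (by linarith) h1
  have mterm : ∀ k i : ℤ, Measurable ((Xset μ k (spt μ k i)).indicator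
      (fun y => ENNReal.ofReal ((spt μ k i - y) ^ (-γ * q)))) := by
    intro k i
    refine (Measurable.indicator ?_ (X_meas _ _ _))
    fun_prop
  unfold Rfun
  rw [lintegral_tsum (fun k => (Measurable.tsum fun i =>
    (mterm k i).const_mul _).aemeasurable)]
  have hG : ∀ k, Measurable fun t => Glev p q k (f t) := fun k => (Glev_meas p q k).comp hf
  calc _ ≤ ∑' k : ℤ, A * (5 * ∫⁻ t, (2:ℝ≥0∞) ^ (-(k:ℝ) * (q * (1 - 1 / p))) *
        Glev p q k (f t) ∂μ) := by
        refine ENNReal.tsum_le_tsum fun k => ?_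
        rw [lintegral_tsum (fun i => ((mterm k i).const_mul _).aemeasurable)]
        rw [lintegral_const_mul _ (hG k)]
        calc _ ≤ ∑' i : ℤ, (∫⁻ t in Pset μ k i, Glev p q k (f t) ∂μ) *
              (A * (2:ℝ≥0∞) ^ (-(k:ℝ) * (q * (1 - 1 / p)))) := by
              refine ENNReal.tsum_le_tsum fun i => ?_
              rw [lintegral_const_mul _ (mterm k i), lintegral_indicator (X_meas _ _ _)]
              exact mul_le_mul_right (X_bound μ A _ he k _ ν _ (hA _)) _
          _ ≤ (5 * ∫⁻ t, Glev p q k (f t) ∂μ) * (A * (2:ℝ≥0∞) ^ (-(k:ℝ) * (q * (1 - 1 / p)))) := by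
              rw [ENNReal.tsum_mul_right]
              exact mul_le_mul_left (P_sum μ hfin k _ (hG k)) _
          _ = _ := by ring
    _ = A * (5 * ∫⁻ t, ∑' k : ℤ, (2:ℝ≥0∞) ^ (-(k:ℝ) * (q * (1 - 1 / p))) *
        Glev p q k (f t) ∂μ) := by
        rw [ENNReal.tsum_mul_left, ENNReal.tsum_mul_left,
          lintegral_tsum (fun k => ((hG k).const_mul _).aemeasurable)]
    _ ≤ A * (5 * ∫⁻ t, 2 ^ q * (∑' m : ℤ, gser p q m) * f t ^ p ∂μ) := by
        gcongr with t
        exact level_sum p q hp hpq _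
    _ ≤ A * (5 * (2 ^ q * (∑' m : ℤ, gser p q m) * 1)) := by
        rw [lintegral_const_mul _ (by fun_prop)]
        gcongr
    _ = _ := by rw [mul_one]

def Cgam (γ : ℝ) : ℝ≥0∞ := ∑' n : ℕ, (2:ℝ≥0∞) ^ (-(n:ℝ) * γ)

lemma M_bound {p q γ : ℝ} (hp : 1 < p) (hpq : p < q) (hγ : 0 < γ) (μ : Measure ℝ)
    [NullSingletonClass μ]
    (hfin : ∀ a b, μ (Ioc a b) < ∞)
    (hpos : ∀ a b, a < b → 0 < μ (Ioc a b)) (f : ℝ → ℝ≥0∞)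
    (hf : Measurable f) (hf1 : ∫⁻ t, f t ^ p ∂μ ≤ 1) (x h : ℝ) (hh : 0 < h) :
    ENNReal.ofReal (h ^ (-γ)) * (∫⁻ t in Ioc x (x + h), f t ∂μ) ≤
      Cgam γ * (2 ^ (q - 1) * 2 ^ (q - 1) * Rfun p q γ μ f x) ^ (1 / q) := by
  have hq : 0 < q := by linarith
  set K := (2 ^ (q - 1) * 2 ^ (q - 1) * Rfun p q γ μ f x) ^ (1 / q) with hK
  have hstep : ∀ h : ℝ, 0 < h →
      ENNReal.ofReal (h ^ (-γ)) * (∫⁻ t in Ioc (x + h / 2) (x + h), f t ∂μ) ≤ K := by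
    intro h hh
    have := ENNReal.rpow_le_rpow (key_pt hp hpq hγ μ hfin hpos f hf hf1 x h hh)
      (show 0 ≤ 1 / q by positivity)
    rw [← hK] at this
    refine le_trans (le_of_eq ?_) this
    rw [ENNReal.mul_rpow_of_nonneg _ _ (by positivity), ← ENNReal.rpow_mul,
      ENNReal.ofReal_rpow_of_pos (by positivity), ← Real.rpow_mul hh.le,
      mul_one_div_cancel hq.ne', ENNReal.rpow_one, mul_assoc, mul_one_div_cancel hq.ne', mul_one]
  have hcov : Ioc x (x + h) ⊆ ⋃ n : ℕ, Ioc (x + h / 2 ^ n / 2) (x + h / 2 ^ n) := by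
    intro t ht
    obtain ⟨n, hn1, hn2⟩ := exists_nat_pow_near_of_lt_one (x := (t - x) / h) (y := 1 / 2)
      (div_pos (by linarith [ht.1]) hh) ((div_le_one hh).2 (by linarith [ht.2]))
      (by norm_num) (by norm_num)
    rw [lt_div_iff₀ hh] at hn1
    rw [div_le_iff₀ hh] at hn2
    refine mem_iUnion.2 ⟨n, ?_, ?_⟩
    · have : h / 2 ^ n / 2 = (1 / 2) ^ (n + 1) * h := by
        rw [pow_succ, one_div_pow]; ring
      rw [this]; linarith
    · have : h / 2 ^ n = (1 / 2) ^ n * h := by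
        rw [one_div_pow]; ring
      rw [this]; linarith
  calc ENNReal.ofReal (h ^ (-γ)) * (∫⁻ t in Ioc x (x + h), f t ∂μ)
      ≤ ENNReal.ofReal (h ^ (-γ)) *
        ∑' n : ℕ, ∫⁻ t in Ioc (x + h / 2 ^ n / 2) (x + h / 2 ^ n), f t ∂μ := by
        gcongr
        exact (lintegral_mono_set hcov).trans (lintegral_iUnion_le _ _)
    _ = ∑' n : ℕ, (2:ℝ≥0∞) ^ (-(n:ℝ) * γ) * (ENNReal.ofReal ((h / 2 ^ n) ^ (-γ)) *
          ∫⁻ t in Ioc (x + h / 2 ^ n / 2) (x + h / 2 ^ n), f t ∂μ) := by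
        rw [← ENNReal.tsum_mul_left]
        congr 1; ext n
        rw [← mul_assoc]
        congr 1
        have : (2:ℝ≥0∞) ^ (-(n:ℝ) * γ) = ENNReal.ofReal ((2:ℝ) ^ (-(n:ℝ) * γ)) := by
          rw [← ENNReal.ofReal_rpow_of_pos (by norm_num)]; simp
        rw [this, ← ENNReal.ofReal_mul (by positivity)]
        congr 1
        rw [Real.div_rpow hh.le (by positivity), ← Real.rpow_natCast, ← Real.rpow_mul (by norm_num),
          mul_div_assoc', mul_comm, mul_div_assoc, show (n:ℝ) * -γ = -(n:ℝ) * γ by ring,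
          div_self (by positivity), mul_one]
    _ ≤ ∑' n : ℕ, (2:ℝ≥0∞) ^ (-(n:ℝ) * γ) * K := by
        gcongr with n
        exact hstep _ (by positivity)
    _ = _ := by rw [ENNReal.tsum_mul_right]; rfl

lemma pos_int {g : ℝ → ℝ≥0∞} (hg : AEMeasurable g volume) (hpos : ∀ᵐ x : ℝ, 0 < g x)
    {s : Set ℝ} (hs : volume s ≠ 0) : 0 < ∫⁻ x in s, g x := by
  rw [pos_iff_ne_zero]
  intro h
  rw [lintegral_eq_zero_iff' hg.restrict] at h
  have h2 := ae_restrict_of_ae (s := s) hpos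
  have : ∀ᵐ x ∂(volume.restrict s), False := by
    filter_upwards [h, h2] with x h3 h4
    rw [h3] at h4; simp at h4
  rw [ae_iff] at this
  simp at this
  exact hs this

def Cbig (p q γ : ℝ) : ℝ≥0∞ :=
  (Cgam γ ^ q * (2 ^ (q - 1) * 2 ^ (q - 1) * (5 * (2 ^ q * (∑' m : ℤ, gser p q m))))) ^ (1 / q)

lemma Cbig_ne_top {p q γ : ℝ} (hp : 1 < p) (hpq : p < q) (hγ : 0 < γ) : Cbig p q γ ≠ ∞ := by
  unfold Cbig
  have h1 : Cgam γ ≠ ∞ := geo_ne_top γ hγ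
  have h2 := gser_ne_top p q hp hpq
  have hq : 0 < q := by linarith
  refine ENNReal.rpow_ne_top_of_nonneg (by positivity) ?_
  have h3 : ∀ r : ℝ, 0 ≤ r → (2:ℝ≥0∞) ^ r ≠ ∞ := fun r hr =>
    ENNReal.rpow_ne_top_of_nonneg hr (by norm_num)
  have h4 := h3 (q - 1) (by linarith)
  have h5 := h3 q (by linarith)
  exact ENNReal.mul_ne_top (ENNReal.rpow_ne_top_of_nonneg hq.le h1) (ENNReal.mul_ne_top
    (ENNReal.mul_ne_top h4 h4) (ENNReal.mul_ne_top (by norm_num) (ENNReal.mul_ne_top h5 h2)))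

lemma AGK_le (α p q : ℝ) (hq : 0 < q) (v w : ℝ → ℝ) (s η : ℝ) (hη : 0 < η) :
    (∫⁻ t in Ioc (s - η) (s + η), ENNReal.ofReal (w t ^ (1 - p / (p - 1)))) ^ (q * (1 - 1 / p)) *
      (∫⁻ y in Iio (s - η), ENNReal.ofReal (v y) * ENNReal.ofReal ((s - y) ^ (-(1 - α) * q))) ≤
      AGKplus α p q v w ^ q := by
  have h1 : (∫⁻ t in Ioc (s - η) (s + η), ENNReal.ofReal (w t ^ (1 - p / (p - 1)))) ^ (1 - 1 / p) *
      (∫⁻ y in Iio (s - η), ENNReal.ofReal (v y * (s - y) ^ (-(1 - α) * q))) ^ (1 / q)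
      ≤ AGKplus α p q v w := by
    unfold AGKplus
    exact le_iSup_of_le s (le_iSup_of_le η (le_iSup_of_le hη le_rfl))
  have h2 := ENNReal.rpow_le_rpow h1 hq.le
  refine le_trans (le_of_eq ?_) h2
  rw [ENNReal.mul_rpow_of_nonneg _ _ hq.le, ← ENNReal.rpow_mul, ← ENNReal.rpow_mul,
    one_div_mul_cancel hq.ne', ENNReal.rpow_one, mul_comm q]
  congr 1
  refine setLIntegral_congr_fun measurableSet_Iio fun y hy => ?_
  have : y < s - η := hy
  rw [ENNReal.ofReal_mul' (Real.rpow_nonneg (by linarith) _)]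

section
variable {p q α : ℝ} {v w : ℝ → ℝ}

lemma sig_aem (hw : IsWeight w) :
    AEMeasurable (fun t => ENNReal.ofReal (w t ^ (1 - p / (p - 1)))) volume := by
  have := hw.2.aestronglyMeasurable.aemeasurable
  fun_prop

lemma sig_pos (hw : IsWeight w) : ∀ᵐ t : ℝ, 0 < ENNReal.ofReal (w t ^ (1 - p / (p - 1))) := by
  filter_upwards [hw.1] with t ht
  exact ENNReal.ofReal_pos.2 (Real.rpow_pos_of_pos ht _)

lemma S_pos (hw : IsWeight w) {a b : ℝ} (h : a < b) :
    0 < ∫⁻ t in Ioc a b, ENNReal.ofReal (w t ^ (1 - p / (p - 1))) :=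
  pos_int (sig_aem hw) (sig_pos hw) (by simp [h])

lemma V_pos (hv : IsWeight v) {s η : ℝ} (hη : 0 < η) :
    0 < ∫⁻ y in Iio (s - η), ENNReal.ofReal (v y) * ENNReal.ofReal ((s - y) ^ (-(1 - α) * q)) := by
  have hm := hv.2.aestronglyMeasurable.aemeasurable
  refine lt_of_lt_of_le ?_ (lintegral_mono_set (Ioo_subset_Iio_self (a := s - η - 1)))
  have : ∫⁻ y in Ioo (s - η - 1) (s - η), ENNReal.ofReal (v y) * ENNReal.ofReal ((s - y) ^ (-(1 - α) * q))
    = ∫⁻ y in Ioo (s - η - 1) (s - η), ENNReal.ofReal (v y) * ENNReal.ofReal (|s - y| ^ (-(1 - α) * q)) := by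
    refine setLIntegral_congr_fun measurableSet_Ioo fun y hy => ?_
    rw [abs_of_pos (by linarith [hy.2])]
  rw [this]
  refine pos_int (by fun_prop) ?_ (by simp)
  have hne : ∀ᵐ y : ℝ, y ≠ s := by
    simp [ae_iff]
  filter_upwards [hv.1, hne] with y hy hys
  have : 0 < |s - y| := abs_pos.2 (sub_ne_zero.2 hys.symm)
  have h2 : 0 < |s - y| ^ (-(1 - α) * q) := Real.rpow_pos_of_pos this _
  exact ENNReal.mul_pos (ENNReal.ofReal_pos.2 hy).ne' (ENNReal.ofReal_pos.2 h2).ne'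

lemma AGK_ne_zero (hq : 0 < q) (hv : IsWeight v) (hw : IsWeight w) (hp : 1 < p) :
    AGKplus α p q v w ≠ 0 := by
  intro h
  have h1 : 0 < 1 - 1 / p := by rw [sub_pos, div_lt_iff₀ (by linarith)]; linarith
  have := AGK_le α p q hq v w 0 1 one_pos
  rw [h, ENNReal.zero_rpow_of_pos hq] at this
  have h3 : 0 < (∫⁻ t in Ioc (0 - 1) (0 + 1), ENNReal.ofReal (w t ^ (1 - p / (p - 1)))) ^ (q * (1 - 1 / p)) :=
    ENNReal.rpow_pos_of_nonneg (S_pos hw (by norm_num)) (by positivity)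
  exact absurd this (not_le.2 (ENNReal.mul_pos h3.ne' (V_pos hv one_pos).ne'))

lemma S_fin (hq : 0 < q) (hv : IsWeight v) (hp : 1 < p)
    (hA : AGKplus α p q v w ≠ ∞) (a b : ℝ) :
    ∫⁻ t in Ioc a b, ENNReal.ofReal (w t ^ (1 - p / (p - 1))) < ∞ := by
  rcases le_or_gt b a with h | h
  · simp [h]
  have h1 : 0 < 1 - 1 / p := by rw [sub_pos, div_lt_iff₀ (by linarith)]; linarith
  rw [lt_top_iff_ne_top]
  intro htop
  have := AGK_le α p q hq v w ((a + b) / 2) ((b - a) / 2) (by linarith)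
  rw [show (a + b) / 2 - (b - a) / 2 = a by ring, show (a + b) / 2 + (b - a) / 2 = b by ring, htop,
    ENNReal.top_rpow_of_pos (by positivity), ENNReal.top_mul, top_le_iff] at this
  · exact ENNReal.rpow_ne_top_of_nonneg hq.le hA this
  · have := V_pos (α := α) (q := q) hv (s := (a + b) / 2) (η := (b - a) / 2) (by linarith)
    rw [show (a + b) / 2 - (b - a) / 2 = a by ring] at this
    exact this.ne'

lemma upper_core (hp : 1 < p) (hpq : p < q) (hα1 : α < 1)
    (hv : IsWeight v) (hw : IsWeight w) (hA : AGKplus α p q v w ≠ ∞)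
    (F : ℝ → ℝ≥0∞) (hF : Measurable F) (N : ℝ≥0∞)
    (hN : ∫⁻ t, F t ^ p * ENNReal.ofReal (w t) = N) (hN0 : N ≠ 0) (hNt : N ≠ ∞) :
    (∫⁻ x, (⨆ (h : ℝ) (_ : 0 < h), ENNReal.ofReal (h ^ (α - 1)) * ∫⁻ t in Ioc x (x + h), F t) ^ q
      * ENNReal.ofReal (v x)) ^ (1 / q) ≤
      Cbig p q (1 - α) * AGKplus α p q v w * N ^ (1 / p) := by
  have hq : 0 < q := by linarith
  have hp0 : 0 < p := by linarith
  have hγ : 0 < 1 - α := by linarith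
  have hvm : AEMeasurable (fun x => ENNReal.ofReal (v x)) volume :=
    hv.2.aestronglyMeasurable.aemeasurable.ennreal_ofReal
  set σ := (sig_aem (p := p) hw).mk _ with hσ
  have mσ : Measurable σ := (sig_aem (p := p) hw).measurable_mk
  have eσ : (fun t => ENNReal.ofReal (w t ^ (1 - p / (p - 1)))) =ᵐ[volume] σ :=
    (sig_aem (p := p) hw).ae_eq_mk
  set μ := (volume : Measure ℝ).withDensity σ with hμ
  have μI : ∀ a b, μ (Ioc a b) = ∫⁻ t in Ioc a b, ENNReal.ofReal (w t ^ (1 - p / (p - 1))) := by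
    intro a b
    rw [hμ, withDensity_apply _ measurableSet_Ioc]
    exact lintegral_congr_ae (ae_restrict_of_ae eσ.symm)
  have hfin : ∀ a b, μ (Ioc a b) < ∞ := fun a b => by rw [μI]; exact S_fin hq hv hp hA a b
  have hpos : ∀ a b, a < b → 0 < μ (Ioc a b) := fun a b h => by rw [μI]; exact S_pos hw h
  set M := N ^ (1 / p) with hM
  have hM0 : M ≠ 0 := by simp [hM, ENNReal.rpow_eq_zero_iff, hN0, hNt]
  have hMt : M ≠ ∞ := ENNReal.rpow_ne_top_of_nonneg (by positivity) hNt
  have hMp : M ^ p = N := by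
    rw [hM, ← ENNReal.rpow_mul, one_div_mul_cancel hp0.ne', ENNReal.rpow_one]
  set f : ℝ → ℝ≥0∞ := fun t => M⁻¹ * (F t / σ t) with hf
  have mf : Measurable f := by fun_prop
  have hf1 : ∫⁻ t, f t ^ p ∂μ ≤ 1 := by
    rw [hμ, lintegral_withDensity_eq_lintegral_mul _ mσ (by fun_prop)]
    calc _ = ∫⁻ t, N⁻¹ * (F t ^ p * ENNReal.ofReal (w t)) := by
          refine lintegral_congr_ae ?_
          filter_upwards [eσ, hw.1] with t ht hwt
          have hs : 0 < w t ^ (1 - p / (p - 1)) := Real.rpow_pos_of_pos hwt _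
          have hs0 : σ t ≠ 0 := by rw [← ht]; exact (ENNReal.ofReal_pos.2 hs).ne'
          have hst : σ t ≠ ∞ := by rw [← ht]; exact ENNReal.ofReal_ne_top
          have e : σ t ^ (1 - p) = ENNReal.ofReal (w t) := by
            rw [← ht, ENNReal.ofReal_rpow_of_pos hs, ← Real.rpow_mul hwt.le]
            have : (1 - p / (p - 1)) * (1 - p) = 1 := by
              have : p - 1 ≠ 0 := by linarith
              field_simp; ring
            rw [this, Real.rpow_one]
          simp only [Pi.mul_apply, hf]
          rw [ENNReal.mul_rpow_of_nonneg _ _ hp0.le, ENNReal.div_rpow_of_nonneg _ _ hp0.le,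
            ENNReal.inv_rpow, hMp, ← e, ENNReal.rpow_sub _ _ hs0 hst, ENNReal.rpow_one]
          simp only [div_eq_mul_inv]; ring
      _ = N⁻¹ * N := by
          rw [lintegral_const_mul', hN]
          exact ENNReal.inv_ne_top.2 hN0
      _ ≤ 1 := by rw [ENNReal.inv_mul_cancel hN0 hNt]
  have hint : ∀ a b, ∫⁻ t in Ioc a b, F t = M * ∫⁻ t in Ioc a b, f t ∂μ := by
    intro a b
    rw [hμ, setLIntegral_withDensity_eq_setLIntegral_mul _ mσ mf measurableSet_Ioc,
      ← lintegral_const_mul' _ _ hMt]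
    refine lintegral_congr_ae (ae_restrict_of_ae ?_)
    filter_upwards [eσ, hw.1] with t ht hwt
    have hs : 0 < w t ^ (1 - p / (p - 1)) := Real.rpow_pos_of_pos hwt _
    have hs0 : σ t ≠ 0 := by rw [← ht]; exact (ENNReal.ofReal_pos.2 hs).ne'
    have hst : σ t ≠ ∞ := by rw [← ht]; exact ENNReal.ofReal_ne_top
    simp only [Pi.mul_apply, hf]
    rw [show M * (σ t * (M⁻¹ * (F t / σ t))) = (M * M⁻¹) * (σ t * (F t / σ t)) by ring,
      ENNReal.mul_inv_cancel hM0 hMt, one_mul, ENNReal.mul_div_cancel hs0 hst]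
  set R := Rfun p q (1 - α) μ f with hR
  set c0 : ℝ≥0∞ := 2 ^ (q - 1) * 2 ^ (q - 1) with hc0
  have hsup : ∀ x, (⨆ (h : ℝ) (_ : 0 < h), ENNReal.ofReal (h ^ (α - 1)) *
      ∫⁻ t in Ioc x (x + h), F t) ^ q ≤ M ^ q * Cgam (1 - α) ^ q * c0 * R x := by
    intro x
    have : (⨆ (h : ℝ) (_ : 0 < h), ENNReal.ofReal (h ^ (α - 1)) *
      ∫⁻ t in Ioc x (x + h), F t) ≤ M * (Cgam (1 - α) * (c0 * R x) ^ (1 / q)) := by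
      refine iSup₂_le fun h hh => ?_
      have := M_bound hp hpq hγ μ hfin hpos f mf hf1 x h hh
      rw [neg_sub] at this
      rw [hint, mul_left_comm]
      exact mul_le_mul_right this _
    refine (ENNReal.rpow_le_rpow this hq.le).trans (le_of_eq ?_)
    rw [ENNReal.mul_rpow_of_nonneg _ _ hq.le, ENNReal.mul_rpow_of_nonneg _ _ hq.le,
      ← ENNReal.rpow_mul (c0 * R x), one_div_mul_cancel hq.ne', ENNReal.rpow_one]
    ring
  set ν := (volume : Measure ℝ).withDensity (fun x => ENNReal.ofReal (v x)) with hν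
  have hRint := R_int hp hpq μ ν hfin f mf hf1 (γ := 1 - α) (AGKplus α p q v w ^ q) (by
    intro s η hη
    rw [μI]
    refine le_trans (le_of_eq ?_) (AGK_le α p q hq v w s η hη)
    congr 1
    rw [hν, restrict_withDensity measurableSet_Iio,
      lintegral_withDensity_eq_lintegral_mul₀ hvm.restrict (by fun_prop)]
    rfl)
  have mR : Measurable R := R_meas _ _ _ _ _
  have htot : ∫⁻ x, (⨆ (h : ℝ) (_ : 0 < h), ENNReal.ofReal (h ^ (α - 1)) *
      ∫⁻ t in Ioc x (x + h), F t) ^ q * ENNReal.ofReal (v x) ≤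
      M ^ q * Cgam (1 - α) ^ q * c0 *
        (AGKplus α p q v w ^ q * (5 * (2 ^ q * (∑' m : ℤ, gser p q m)))) := by
    calc _ ≤ ∫⁻ x, ENNReal.ofReal (v x) * (M ^ q * Cgam (1 - α) ^ q * c0 * R x) := by
          refine lintegral_mono fun x => ?_
          rw [mul_comm]
          exact mul_le_mul_right (hsup x) _
      _ = ∫⁻ x, M ^ q * Cgam (1 - α) ^ q * c0 * R x ∂ν := by
          rw [hν, lintegral_withDensity_eq_lintegral_mul₀ hvm (by fun_prop)]
          rfl
      _ = M ^ q * Cgam (1 - α) ^ q * c0 * ∫⁻ x, R x ∂ν := lintegral_const_mul _ mR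
      _ ≤ _ := mul_le_mul_right hRint _
  refine (ENNReal.rpow_le_rpow htot (by positivity)).trans (le_of_eq ?_)
  have : M ^ q * Cgam (1 - α) ^ q * c0 *
        (AGKplus α p q v w ^ q * (5 * (2 ^ q * (∑' m : ℤ, gser p q m)))) =
      (Cgam (1 - α) ^ q * (c0 * (5 * (2 ^ q * (∑' m : ℤ, gser p q m))))) *
        AGKplus α p q v w ^ q * M ^ q := by ring
  rw [this, ENNReal.mul_rpow_of_nonneg _ _ (by positivity),
    ENNReal.mul_rpow_of_nonneg _ _ (by positivity), ← ENNReal.rpow_mul M, ← ENNReal.rpow_mul (AGKplus _ _ _ _ _),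
    mul_one_div_cancel hq.ne', ENNReal.rpow_one, ENNReal.rpow_one]
  rfl

lemma upper (hp : 1 < p) (hpq : p < q) (hα1 : α < 1)
    (hv : IsWeight v) (hw : IsWeight w) (f : ℝ → ℝ) :
    lnormW q v (MplusAlpha α f) ≤
      ENNReal.ofReal ((Cbig p q (1 - α)).toReal + 1) * AGKplus α p q v w *
        lnormW p w (fun x => ENNReal.ofReal |f x|) := by
  have hq : 0 < q := by linarith
  have hp0 : 0 < p := by linarith
  obtain ⟨F, mF, hFf, hFd⟩ := exists_measurable_le_withDensity_eq (volume : Measure ℝ)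
    (fun x => ENNReal.ofReal |f x|)
  have hI : ∀ a b, ∫⁻ t in Ioc a b, ENNReal.ofReal |f t| = ∫⁻ t in Ioc a b, F t := by
    intro a b
    rw [← withDensity_apply _ measurableSet_Ioc, ← withDensity_apply _ measurableSet_Ioc, hFd]
  set N := ∫⁻ t, F t ^ p * ENNReal.ofReal (w t) with hN
  have hNle : N ^ (1 / p) ≤ lnormW p w (fun x => ENNReal.ofReal |f x|) := by
    unfold lnormW
    exact ENNReal.rpow_le_rpow (lintegral_mono fun t =>
      mul_le_mul_left (ENNReal.rpow_le_rpow (hFf t) hp0.le) _) (by positivity)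
  refine le_trans ?_ (mul_le_mul_right hNle _)
  have hLHS : lnormW q v (MplusAlpha α f) =
    (∫⁻ x, (⨆ (h : ℝ) (_ : 0 < h), ENNReal.ofReal (h ^ (α - 1)) * ∫⁻ t in Ioc x (x + h), F t) ^ q
      * ENNReal.ofReal (v x)) ^ (1 / q) := by
    unfold lnormW MplusAlpha
    simp_rw [hI]
  rw [hLHS]
  have hc : Cbig p q (1 - α) ≤ ENNReal.ofReal ((Cbig p q (1 - α)).toReal + 1) := by
    refine (ENNReal.le_ofReal_iff_toReal_le (Cbig_ne_top hp hpq (by linarith)) (by positivity)).2 ?_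
    linarith
  rcases eq_or_ne N 0 with h0 | h0
  · have hwm := hw.2.aestronglyMeasurable.aemeasurable
    rw [hN, lintegral_eq_zero_iff' (by fun_prop)] at h0
    have hF0 : F =ᵐ[volume] 0 := by
      filter_upwards [h0, hw.1] with t ht hwt
      simp only [Pi.zero_apply, mul_eq_zero, ENNReal.ofReal_eq_zero, ENNReal.rpow_eq_zero_iff] at ht
      rcases ht with (h | h) | h
      · exact h.1
      · linarith [h.2]
      · linarith
    have hz : ∀ a b, ∫⁻ t in Ioc a b, F t = 0 := by
      intro a b
      rw [lintegral_congr_ae (ae_restrict_of_ae hF0)]; simp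
    simp_rw [hz]
    simp [ENNReal.zero_rpow_of_pos hq, hq]
  rcases eq_or_ne (AGKplus α p q v w) ∞ with hA | hA
  · rw [hA, ENNReal.mul_top, ENNReal.top_mul]
    · exact le_top
    · intro h
      rw [ENNReal.rpow_eq_zero_iff] at h
      rcases h with h | h
      · exact h0 h.1
      · have : 0 < 1 / p := by positivity
        linarith [h.2]
    · exact (ENNReal.ofReal_pos.2 (by positivity)).ne'
  rcases eq_or_ne N ∞ with ht | ht
  · rw [ht, ENNReal.top_rpow_of_pos (by positivity), ENNReal.mul_top]
    · exact le_top
    · exact mul_ne_zero (ENNReal.ofReal_pos.2 (by positivity)).ne' (AGK_ne_zero hq hv hw hp)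
  · refine (upper_core hp hpq hα1 hv hw hA F mF N hN.symm h0 ht).trans ?_
    gcongr

lemma lower_n (hp : 1 < p) (hq : 0 < q) (hα1 : α < 1)
    (hv : IsWeight v) (hw : IsWeight w) (C : ℝ≥0∞)
    (hC : ∀ f : ℝ → ℝ, lnormW q v (MplusAlpha α f) ≤
      C * lnormW p w (fun x => ENNReal.ofReal |f x|)) (a h : ℝ) (hh : 0 < h) (n : ℕ)
    (hn : 0 < n) :
    ENNReal.ofReal (2 ^ (α - 1)) *
      ((∫⁻ t in Ioc (a - h) (a + h), min (ENNReal.ofReal (w t ^ (1 - p / (p - 1)))) n) ^ (1 - 1 / p) *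
      (∫⁻ y in Iio (a - h), ENNReal.ofReal (v y * (a - y) ^ (-(1 - α) * q))) ^ (1 / q)) ≤ C := by
  have hp0 : 0 < p := by linarith
  have hn' : (0:ℝ) < n := by exact_mod_cast hn
  set S := ∫⁻ t in Ioc (a - h) (a + h), min (ENNReal.ofReal (w t ^ (1 - p / (p - 1)))) n with hS
  set V := ∫⁻ y in Iio (a - h), ENNReal.ofReal (v y * (a - y) ^ (-(1 - α) * q)) with hV
  have hS0 : S ≠ 0 := by
    refine (pos_int ((sig_aem hw).min aemeasurable_const) ?_ (by simp; linarith)).ne'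
    filter_upwards [sig_pos (p := p) hw] with t ht
    exact lt_min ht (by exact_mod_cast hn)
  have hSt : S ≠ ∞ := by
    have : S ≤ ∫⁻ t in Ioc (a - h) (a + h), (n:ℝ≥0∞) := lintegral_mono fun t => min_le_right _ _
    refine ne_top_of_le_ne_top ?_ this
    simp [ENNReal.mul_eq_top]
  set f : ℝ → ℝ := (Ioc (a - h) (a + h)).indicator
    (fun t => min (w t ^ (1 - p / (p - 1))) n) with hf
  have fI : ∀ᵐ t : ℝ, ENNReal.ofReal |f t| = (Ioc (a - h) (a + h)).indicator
      (fun t => min (ENNReal.ofReal (w t ^ (1 - p / (p - 1)))) n) t := by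
    filter_upwards [hw.1] with t ht
    by_cases hm : t ∈ Ioc (a - h) (a + h)
    · simp only [hf, indicator_of_mem hm]
      rw [abs_of_nonneg (le_min (Real.rpow_nonneg ht.le _) hn'.le), ENNReal.ofReal_min]
      simp
    · simp [hf, indicator_of_notMem hm]
  have hnorm : lnormW p w (fun x => ENNReal.ofReal |f x|) ≤ S ^ (1 / p) := by
    unfold lnormW
    refine ENNReal.rpow_le_rpow ?_ (by positivity)
    rw [hS, ← lintegral_indicator measurableSet_Ioc]
    refine lintegral_mono_ae ?_
    filter_upwards [fI, hw.1] with t ht hwt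
    rw [ht]
    by_cases hm : t ∈ Ioc (a - h) (a + h)
    · simp only [indicator_of_mem hm]
      set σ := ENNReal.ofReal (w t ^ (1 - p / (p - 1))) with hσ
      have hs : 0 < w t ^ (1 - p / (p - 1)) := Real.rpow_pos_of_pos hwt _
      have e : σ ^ (p - 1) * ENNReal.ofReal (w t) = 1 := by
        rw [hσ, ENNReal.ofReal_rpow_of_pos hs, ← Real.rpow_mul hwt.le]
        have : (1 - p / (p - 1)) * (p - 1) = -1 := by
          have : p - 1 ≠ 0 := by linarith
          field_simp; ring
        rw [this, ← ENNReal.ofReal_mul (by positivity), Real.rpow_neg_one,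
          inv_mul_cancel₀ hwt.ne', ENNReal.ofReal_one]
      set m := min σ (n:ℝ≥0∞) with hm
      calc m ^ p * ENNReal.ofReal (w t) = m * (m ^ (p - 1) * ENNReal.ofReal (w t)) := by
            rw [← mul_assoc]; congr 1
            nth_rewrite 2 [← ENNReal.rpow_one m]
            rw [← ENNReal.rpow_add_of_nonneg _ _ (by linarith) (by linarith)]
            simp
        _ ≤ m * (σ ^ (p - 1) * ENNReal.ofReal (w t)) := by
            refine mul_le_mul_right (mul_le_mul_left
              (ENNReal.rpow_le_rpow (min_le_left _ _) (by linarith)) _) _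
        _ = m := by rw [e, mul_one]
    · simp [indicator_of_notMem hm, hp0]
  have hlow : ENNReal.ofReal (2 ^ (α - 1)) * (S * V ^ (1 / q)) ≤ lnormW q v (MplusAlpha α f) := by
    set c : ℝ≥0∞ := ENNReal.ofReal (2 ^ (α - 1)) * S with hc
    have hct : c ≠ ∞ := ENNReal.mul_ne_top ENNReal.ofReal_ne_top hSt
    have : c ^ q * V ≤ ∫⁻ x, MplusAlpha α f x ^ q * ENNReal.ofReal (v x) := by
      calc c ^ q * V = ∫⁻ y in Iio (a - h), c ^ q *
            ENNReal.ofReal (v y * (a - y) ^ (-(1 - α) * q)) := by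
            rw [lintegral_const_mul' _ _ (ENNReal.rpow_ne_top_of_nonneg hq.le hct)]
        _ ≤ ∫⁻ y in Iio (a - h), MplusAlpha α f y ^ q * ENNReal.ofReal (v y) := by
            refine setLIntegral_mono' measurableSet_Iio fun y hy => ?_
            have hy' : y < a - h := hy
            have hay : 0 < a - y := by linarith
            have hM : c * ENNReal.ofReal ((a - y) ^ (α - 1)) ≤ MplusAlpha α f y := by
              unfold MplusAlpha
              refine le_iSup₂_of_le (a + h - y) (by linarith) ?_
              rw [hc, mul_right_comm, ← ENNReal.ofReal_mul (by positivity),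
                ← Real.mul_rpow (by norm_num) hay.le]
              refine mul_le_mul' (ENNReal.ofReal_le_ofReal ?_) ?_
              · exact Real.rpow_le_rpow_of_nonpos (by linarith) (by linarith) (by linarith)
              · rw [hS, lintegral_congr_ae (ae_restrict_of_ae fI)]
                rw [lintegral_indicator measurableSet_Ioc,
                  Measure.restrict_restrict measurableSet_Ioc]
                refine lintegral_mono_set fun t ht => ⟨ht, ?_, ?_⟩
                · linarith [ht.1]
                · linarith [ht.2]
            rw [ENNReal.ofReal_mul' (by positivity), mul_comm (ENNReal.ofReal (v y)), ← mul_assoc]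
            refine mul_le_mul_left ?_ _
            refine le_trans (le_of_eq ?_) (ENNReal.rpow_le_rpow hM hq.le)
            rw [ENNReal.mul_rpow_of_nonneg c _ hq.le,
              ENNReal.ofReal_rpow_of_pos (x := (a - y) ^ (α - 1)) (by positivity), ← Real.rpow_mul hay.le, neg_sub]
        _ ≤ _ := setLIntegral_le_lintegral _ _
    have h2 := ENNReal.rpow_le_rpow this (show 0 ≤ 1 / q by positivity)
    refine le_trans (le_of_eq ?_) h2
    rw [ENNReal.mul_rpow_of_nonneg _ _ (by positivity), ← ENNReal.rpow_mul,
      mul_one_div_cancel hq.ne', ENNReal.rpow_one, hc, mul_assoc]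
  have hmain := (hlow.trans (hC f)).trans (mul_le_mul_right hnorm C)
  have h3 := mul_le_mul_right hmain (S ^ (-(1 / p)))
  calc ENNReal.ofReal (2 ^ (α - 1)) * (S ^ (1 - 1 / p) * V ^ (1 / q))
      = S ^ (-(1 / p)) * (ENNReal.ofReal (2 ^ (α - 1)) * (S * V ^ (1 / q))) := by
        rw [show 1 - 1 / p = -(1 / p) + 1 by ring, ENNReal.rpow_add _ _ hS0 hSt, ENNReal.rpow_one]
        ring
    _ ≤ _ := h3
    _ = C := by
        rw [mul_left_comm, ← ENNReal.rpow_add _ _ hS0 hSt]; simp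

lemma lower (hp : 1 < p) (hq : 0 < q) (hα1 : α < 1)
    (hv : IsWeight v) (hw : IsWeight w) (C : ℝ≥0∞)
    (hC : ∀ f : ℝ → ℝ, lnormW q v (MplusAlpha α f) ≤
      C * lnormW p w (fun x => ENNReal.ofReal |f x|)) :
    ENNReal.ofReal (2 ^ (α - 1)) * AGKplus α p q v w ≤ C := by
  have h1 : 0 < 1 - 1 / p := by rw [sub_pos, div_lt_iff₀ (by linarith)]; linarith
  unfold AGKplus
  simp_rw [ENNReal.mul_iSup]
  refine iSup_le fun a => iSup_le fun h => iSup_le fun hh => ?_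
  have hS0 := (S_pos (p := p) hw (show a - h < a + h by linarith)).ne'
  have hlim : Tendsto (fun n : ℕ => ∫⁻ t in Ioc (a - h) (a + h),
      min (ENNReal.ofReal (w t ^ (1 - p / (p - 1)))) n) atTop
      (nhds (∫⁻ t in Ioc (a - h) (a + h), ENNReal.ofReal (w t ^ (1 - p / (p - 1))))) := by
    refine lintegral_tendsto_of_tendsto_of_monotone
      (fun n => ((sig_aem hw).min aemeasurable_const).restrict) ?_ ?_
    · refine Eventually.of_forall fun t m n hmn => ?_
      exact min_le_min_left _ (by exact_mod_cast hmn)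
    · refine Eventually.of_forall fun t => ?_
      have := (tendsto_const_nhds (x := ENNReal.ofReal (w t ^ (1 - p / (p - 1))))).min
        ENNReal.tendsto_nat_nhds_top
      simpa using this
  have hlim2 := (ENNReal.continuous_rpow_const (y := 1 - 1 / p)).continuousAt.tendsto.comp hlim
  have hS1 : (∫⁻ t in Ioc (a - h) (a + h), ENNReal.ofReal (w t ^ (1 - p / (p - 1)))) ^ (1 - 1 / p)
      ≠ 0 := (ENNReal.rpow_pos_of_nonneg (pos_iff_ne_zero.2 hS0) h1.le).ne'
  have hlim3 := ENNReal.Tendsto.const_mul (a := ENNReal.ofReal (2 ^ (α - 1)))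
    (ENNReal.Tendsto.mul_const (b := (∫⁻ y in Iio (a - h),
    ENNReal.ofReal (v y * (a - y) ^ (-(1 - α) * q))) ^ (1 / q)) hlim2 (Or.inl hS1))
    (Or.inr ENNReal.ofReal_ne_top)
  refine le_of_tendsto hlim3 ?_
  filter_upwards [eventually_gt_atTop 0] with n hn
  exact lower_n hp hq hα1 hv hw C hC a h hh n hn

end

/-- Two-weight characterization for `M⁺_α : L^p_w → L^q_v`, `1<p<q<∞`: the operator is
bounded iff `A⁺_{GK}(v,w,p,q) < ∞`, and its operator norm is comparable to
`A⁺_{GK}(v,w,p,q)`, with comparability constants depending only on `p, q, α`.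
The first clause gives the upper bound `‖M⁺_α‖ ≤ c₂ A⁺_{GK}` (in particular
boundedness when the quantity is finite); the second gives `c₁ A⁺_{GK} ≤ C` for any
constant `C` for which the operator is bounded (in particular necessity). -/
theorem stmt7 (p q α : ℝ) (hp : 1 < p) (hpq : p < q) (hα : 0 < α) (hα1 : α < 1) :
    ∃ c₁ c₂ : ℝ, 0 < c₁ ∧ 0 < c₂ ∧
      ∀ v w : ℝ → ℝ, IsWeight v → IsWeight w →
        (∀ f : ℝ → ℝ,
          lnormW q v (MplusAlpha α f) ≤
            ENNReal.ofReal c₂ * AGKplus α p q v w *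
              lnormW p w (fun x => ENNReal.ofReal |f x|)) ∧
        (∀ C : ℝ≥0∞,
          (∀ f : ℝ → ℝ,
            lnormW q v (MplusAlpha α f) ≤
              C * lnormW p w (fun x => ENNReal.ofReal |f x|)) →
          ENNReal.ofReal c₁ * AGKplus α p q v w ≤ C) := by
  refine ⟨2 ^ (α - 1), (Cbig p q (1 - α)).toReal + 1, by positivity, by positivity, ?_⟩
  intro v w hv hw
  refine ⟨fun f => upper hp hpq hα1 hv hw f, fun C hC => ?_⟩
  exact lower hp (by linarith) hα1 hv hw C hC

end
end

section
/- Let 0<α<1, 1<p<1/α, and let q satisfy 1/p − 1/q − α = 0. There exists a constant c depending only on p and α such that for every weight w ∈ A_{p,q}^+(ℝ), ‖w·M⁺_α f‖_{L^q(ℝ)} ≤ c ‖w‖_{A_{p,q}^+(ℝ)}^{(p'/q)(1-α)} ‖w f‖_{L^p(ℝ)} for all f with wf ∈ L^p(ℝ); i.e. ‖M⁺_α‖_{L^p_{w^p}→L^q_{w^q}} ≤ c‖w‖_{A_{p,q}^+(ℝ)}^{(p'/q)(1-α)}. -/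
open MeasureTheory Set Filter
open scoped ENNReal

noncomputable section

/-- `∫_a^b w` as a lower integral. -/
def lintIoc (w : ℝ → ℝ) (a b : ℝ) : ℝ≥0∞ :=
  ∫⁻ t in Set.Ioc a b, ENNReal.ofReal (w t)

/-- Average `(1/(b-a)) ∫_a^b w`. -/
def avgIoc (w : ℝ → ℝ) (a b : ℝ) : ℝ≥0∞ :=
  (ENNReal.ofReal (b - a))⁻¹ * lintIoc w a b

/-- The one-sided `A_{p,q}^+` characteristic:
`sup_{x,h>0} ((1/h)∫_{x-h}^x u^q)((1/h)∫_x^{x+h} u^{-p'})^{q/p'}`, `p' = p/(p-1)`. -/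
def apqPlusChar (p q : ℝ) (u : ℝ → ℝ) : ℝ≥0∞ :=
  ⨆ (x : ℝ) (h : ℝ) (_ : 0 < h),
    avgIoc (fun t => u t ^ q) (x - h) x *
      avgIoc (fun t => u t ^ (-(p / (p - 1)))) x (x + h) ^ (q / (p / (p - 1)))

lemma open_comp_le {O : Set ℝ} (hO : IsOpen O) (hb : BddAbove O) (hb' : BddBelow O)
    (ν ρ : Measure ℝ)
    (h : ∀ α β, α < β → Ioo α β ⊆ O → β ∉ O → ν (Ioo α β) ≤ ρ (Ioo α β)) : ν O ≤ ρ O := by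
  set 𝒞 : Set (Set ℝ) := (connectedComponentIn O) '' O with h𝒞
  have hopen : ∀ C ∈ 𝒞, IsOpen C := by
    rintro _ ⟨x, hx, rfl⟩
    exact hO.connectedComponentIn
  have hne : ∀ C ∈ 𝒞, C.Nonempty := by
    rintro _ ⟨x, hx, rfl⟩
    exact ⟨x, mem_connectedComponentIn hx⟩
  have hd : 𝒞.PairwiseDisjoint id := by
    rintro _ ⟨x, hx, rfl⟩ _ ⟨y, hy, rfl⟩ hxy
    rw [Function.onFun, id, id, Set.disjoint_left]
    intro z hz hz'
    exact hxy ((connectedComponentIn_eq hz).trans (connectedComponentIn_eq hz').symm)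
  have hc : 𝒞.Countable := hd.countable_of_isOpen hopen hne
  have hU : ⋃₀ 𝒞 = O := by
    apply subset_antisymm
    · apply sUnion_subset
      rintro _ ⟨x, hx, rfl⟩
      exact connectedComponentIn_subset O x
    · intro x hx
      exact ⟨_, ⟨x, hx, rfl⟩, mem_connectedComponentIn hx⟩
  rw [← hU, measure_sUnion hc hd (fun t ht => (hopen t ht).measurableSet),
    measure_sUnion hc hd (fun t ht => (hopen t ht).measurableSet)]
  apply ENNReal.tsum_le_tsum
  rintro ⟨C, hC⟩
  have hCo := hopen C hC
  have hCn := hne C hC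
  obtain ⟨x, hx, rfl⟩ := hC
  set C := connectedComponentIn O x
  have hCO : C ⊆ O := connectedComponentIn_subset O x
  have hCc : IsConnected C := ⟨hCn, isPreconnected_connectedComponentIn⟩
  have hCa : BddAbove C := hb.mono hCO
  have hCb : BddBelow C := hb'.mono hCO
  have hlt : ∀ y ∈ C, sInf C < y ∧ y < sSup C := by
    intro y hy
    obtain ⟨ε, hε, hε'⟩ := Metric.isOpen_iff.1 hCo y hy
    have h1 : y + ε / 2 ∈ C := hε' (by simp [abs_of_pos hε, hε.lt])
    have h2 : y - ε / 2 ∈ C := hε' (by simp [abs_of_pos hε, hε.lt])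
    have := le_csSup hCa h1
    have := csInf_le hCb h2
    constructor <;> linarith
  have hCeq : C = Ioo (sInf C) (sSup C) :=
    subset_antisymm (fun y hy => hlt y hy) (hCc.Ioo_csInf_csSup_subset hCb hCa)
  have hxC : x ∈ C := mem_connectedComponentIn hx
  have hβ : sSup C ∉ O := by
    intro hβ
    have h1 : Ioc (sInf C) (sSup C) ⊆ O := by
      intro y hy
      rcases hy.2.eq_or_lt with h | h
      · rw [h]; exact hβ
      · exact hCO (hCeq ▸ (⟨hy.1, h⟩ : y ∈ Ioo (sInf C) (sSup C)))
    have h2 : Ioc (sInf C) (sSup C) ⊆ C :=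
      isPreconnected_Ioc.subset_connectedComponentIn ⟨(hlt x hxC).1, (hlt x hxC).2.le⟩ h1
    have h3 := hlt _ (h2 ⟨(hlt x hxC).1.trans (hlt x hxC).2, le_rfl⟩)
    exact lt_irrefl _ h3.2
  show ν C ≤ ρ C
  have := h (sInf C) (sSup C) ((hlt x hxC).1.trans (hlt x hxC).2) (hCeq ▸ hCO) hβ
  rwa [← hCeq] at this

lemma comp_bound {Φ : ℝ → ℝ} (hΦ : Continuous Φ) (hm : StrictMono Φ) (ν : Measure ℝ) {r k lam α β : ℝ}
    (hr : 0 < r) (hk : 0 < k) (hl : 0 < lam)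
    (hA : ∀ a b c, a < b → b < c →
      ν (Ioc a b) * ENNReal.ofReal ((Φ c - Φ b) ^ r) ≤ ENNReal.ofReal (k * (c - a) ^ (r + 1)))
    (hαβ : α < β) (h : ∀ x ∈ Ioo α β, lam * (β - x) ≤ Φ β - Φ x) :
    ν (Ioo α β) ≤ ENNReal.ofReal (2 * 4 ^ r * k * lam ^ (-r)) * volume (Ioo α β) := by
  have h' : ∀ x ∈ Icc α β, lam * (β - x) ≤ Φ β - Φ x := by
    intro x hx
    have hcl : x ∈ closure (Ioo α β) := by rwa [closure_Ioo hαβ.ne]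
    have : IsClosed {x | lam * (β - x) ≤ Φ β - Φ x} :=
      isClosed_le (by fun_prop) (by fun_prop)
    exact closure_minimal (fun x hx => h x hx) this hcl
  set T := Φ β - Φ α with hT
  have hTpos : 0 < T := lt_of_lt_of_le (mul_pos hl (sub_pos.2 hαβ)) (h' α ⟨le_rfl, hαβ.le⟩)
  have hy : ∀ i : ℕ, ∃ y ∈ Icc α β, Φ β - Φ y = T * (1 / 2) ^ i := by
    intro i
    have h1 : Φ β - T * (1/2)^i ∈ Icc (Φ α) (Φ β) := by
      have h2 : ((1:ℝ)/2)^i ≤ 1 := pow_le_one₀ (by norm_num) (by norm_num)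
      have h3 : (0:ℝ) < (1/2)^i := by positivity
      constructor
      · nlinarith
      · nlinarith
    obtain ⟨y, hy, hy'⟩ := intermediate_value_Icc hαβ.le hΦ.continuousOn h1
    exact ⟨y, hy, by linarith⟩
  choose y hyI hyT using hy
  have hlt : ∀ i, y i < y (i+1) := by
    intro i
    by_contra hcon
    have := hm.monotone (not_lt.1 hcon)
    have h1 := hyT i
    have h2 := hyT (i+1)
    have h3 : (0:ℝ) < T * (1/2)^i := by positivity
    rw [pow_succ] at h2
    nlinarith
  have hmono : StrictMono y := strictMono_nat_of_lt_succ hlt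
  have hstep : ∀ i, ν (Ioc (y i) (y (i+1))) ≤ ENNReal.ofReal (4 ^ r * k * lam ^ (-r)) *
      volume (Ioc (y i) (y (i+2))) := by
    intro i
    have h1 := hA (y i) (y (i+1)) (y (i+2)) (hlt i) (hlt (i+1))
    set d := y (i+2) - y i with hd
    have hdpos : 0 < d := sub_pos.2 (hmono (by omega))
    have h2 : lam * d / 4 ≤ Φ (y (i+2)) - Φ (y (i+1)) := by
      have e1 := hyT i
      have e2 := hyT (i+1)
      have e3 := hyT (i+2)
      have e4 := h' (y i) (hyI i)
      have e5 : lam * d ≤ lam * (β - y i) := by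
        apply mul_le_mul_of_nonneg_left _ hl.le
        have := (hyI (i+2)).2
        linarith
      rw [pow_succ] at e2
      rw [pow_succ, pow_succ] at e3
      nlinarith
    have hpos : 0 < (lam * d / 4) ^ r := by positivity
    have h3 : ν (Ioc (y i) (y (i+1))) * ENNReal.ofReal ((lam * d / 4) ^ r) ≤
        ENNReal.ofReal (k * d ^ (r+1)) := by
      refine le_trans ?_ h1
      gcongr
    rw [Real.volume_Ioc, ← hd, ← ENNReal.ofReal_mul (by positivity)]
    rw [← ENNReal.le_div_iff_mul_le (by left; simpa using hpos) (by left; simp),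
      ← ENNReal.ofReal_div_of_pos hpos] at h3
    refine h3.trans (ENNReal.ofReal_le_ofReal (le_of_eq ?_))
    rw [Real.div_rpow (by positivity) (by norm_num), Real.mul_rpow hl.le hdpos.le,
      Real.rpow_add hdpos, Real.rpow_one, Real.rpow_neg hl.le]
    have : (4:ℝ)^r ≠ 0 := by positivity
    have : lam^r ≠ 0 := by positivity
    have : d^r ≠ 0 := by positivity
    field_simp
  have hy0 : y 0 = α := by
    apply hm.injective
    have := hyT 0
    simp only [pow_zero, mul_one, hT] at this
    linarith
  have htend : Tendsto y atTop (nhds β) := by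
    have h0 : Tendsto (fun i : ℕ => β - T * (1/2:ℝ)^i / lam) atTop (nhds β) := by
      have := (tendsto_pow_atTop_nhds_zero_of_lt_one (r := (1/2:ℝ)) (by norm_num) (by norm_num))
      have := tendsto_const_nhds (x := β).sub ((this.const_mul T).div_const lam)
      simpa using this
    refine tendsto_of_tendsto_of_tendsto_of_le_of_le h0 tendsto_const_nhds ?_ (fun i => (hyI i).2)
    intro i
    have := h' _ (hyI i)
    rw [hyT] at this
    show β - T * (1/2:ℝ)^i / lam ≤ y i
    have : β - y i ≤ T * (1/2:ℝ)^i / lam := by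
      rw [le_div_iff₀ hl]; linarith
    linarith
  have hcov : Ioo α β ⊆ ⋃ i, Ioc (y i) (y (i+1)) := by
    intro x hx
    have hex : ∃ i, x ≤ y i := by
      have := (htend.eventually (lt_mem_nhds hx.2)).exists
      obtain ⟨i, hi⟩ := this
      exact ⟨i, hi.le⟩
    classical
    have hs := Nat.find_spec hex
    have hm' := @Nat.find_min _ _ hex
    rcases hn : Nat.find hex with _ | n
    · rw [hn, hy0] at hs
      exact absurd hx.1 (not_lt.2 hs)
    · rw [hn] at hs
      refine mem_iUnion.2 ⟨n, not_le.1 (hm' (m := n) (by omega)), hs⟩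
  have hdis : ∀ (j : ℕ), Pairwise (Function.onFun Disjoint (fun i => Ioc (y (i+j)) (y (i+j+1)))) := by
    intro j
    have hmon : Monotone (fun i => y (i + j)) := fun a b hab => hmono.monotone (by omega)
    have := hmon.pairwise_disjoint_on_Ioc_succ
    simp only [Order.succ_eq_add_one, add_right_comm _ 1 j] at this
    exact this
  have hsum : ∀ j : ℕ, ∑' i, volume (Ioc (y (i+j)) (y (i+j+1))) ≤ volume (Ioo α β) := by
    intro j
    rw [← measure_iUnion (hdis j) (fun i => measurableSet_Ioc)]
    apply measure_mono
    apply iUnion_subset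
    intro i x hx
    refine ⟨lt_of_le_of_lt (hyI _).1 hx.1, lt_of_le_of_lt hx.2 ?_⟩
    exact lt_of_lt_of_le (hlt _) (hyI (i+j+1+1)).2
  calc ν (Ioo α β) ≤ ν (⋃ i, Ioc (y i) (y (i+1))) := measure_mono hcov
    _ ≤ ∑' i, ν (Ioc (y i) (y (i+1))) := measure_iUnion_le _
    _ ≤ ∑' i, ENNReal.ofReal (4 ^ r * k * lam ^ (-r)) *
        (volume (Ioc (y (i+0)) (y (i+0+1))) + volume (Ioc (y (i+1)) (y (i+1+1)))) := by
      apply ENNReal.tsum_le_tsum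
      intro i
      refine (hstep i).trans ?_
      gcongr
      rw [← Ioc_union_Ioc_eq_Ioc (hlt i).le (hlt (i+1)).le]
      exact measure_union_le _ _
    _ ≤ ENNReal.ofReal (4 ^ r * k * lam ^ (-r)) * (volume (Ioo α β) + volume (Ioo α β)) := by
      rw [ENNReal.tsum_mul_left, ENNReal.tsum_add]
      gcongr
      · exact hsum 0
      · exact hsum 1
    _ = _ := by
      rw [← two_mul, ← mul_assoc, ← ENNReal.ofReal_ofNat 2, ← ENNReal.ofReal_mul (by positivity)]
      congr 2; ring

structure Setup (r k : ℝ) (Φ : ℝ → ℝ) (S : ℝ → ℝ≥0∞) (ν : Measure ℝ) : Prop where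
  hr : 0 < r
  hk : 0 < k
  hΦ : Continuous Φ
  hm : StrictMono Φ
  hS : Measurable S
  hS0 : ∀ x, S x ≠ 0
  hSt : ∀ x, S x ≠ ∞
  hμ : ∀ a b, a ≤ b → ∫⁻ x in Ioc a b, S x = ENNReal.ofReal (Φ b - Φ a)
  hν : ν = volume.withDensity (fun x => S x ^ (-r))
  hA : ∀ a b c, a < b → b < c →
      ν (Ioc a b) * ENNReal.ofReal ((Φ c - Φ b) ^ r) ≤ ENNReal.ofReal (k * (c - a) ^ (r + 1))

def lev (Φ : ℝ → ℝ) (Ω : Set ℝ) (lam : ℝ) : Set ℝ :=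
  {x | ∃ y, x < y ∧ Icc x y ⊆ Ω ∧ lam * (y - x) < Φ y - Φ x}

lemma lev_subset {Φ : ℝ → ℝ} {Ω : Set ℝ} {lam : ℝ} : lev Φ Ω lam ⊆ Ω := by
  rintro x ⟨y, hxy, hy, _⟩
  exact hy ⟨le_rfl, hxy.le⟩

lemma lev_open {Φ : ℝ → ℝ} (hΦ : Continuous Φ) {Ω : Set ℝ} (hΩ : IsOpen Ω) {lam : ℝ} :
    IsOpen (lev Φ Ω lam) := by
  rw [isOpen_iff_mem_nhds]
  rintro x ⟨y, hxy, hy, hF⟩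
  have h1 : ∀ᶠ x' in nhds x, x' < y := gt_mem_nhds hxy
  have h2 : ∀ᶠ x' in nhds x, lam * (y - x') < Φ y - Φ x' := by
    have : IsOpen {x' | lam * (y - x') < Φ y - Φ x'} :=
      isOpen_lt (by fun_prop) (by fun_prop)
    exact this.mem_nhds hF
  have h3 : ∀ᶠ x' in nhds x, Icc x' y ⊆ Ω := by
    obtain ⟨ε, hε, hε'⟩ := Metric.isOpen_iff.1 hΩ x (hy ⟨le_rfl, hxy.le⟩)
    filter_upwards [Metric.ball_mem_nhds x hε] with x' hx' z hz
    by_cases hzx : x ≤ z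
    · exact hy ⟨hzx, hz.2⟩
    · apply hε'
      rw [Metric.mem_ball, Real.dist_eq, abs_lt] at *
      push Not at hzx
      constructor <;> linarith [hz.1, hz.2, hx'.1, hx'.2]
  filter_upwards [h1, h2, h3] with x' a b c
  exact ⟨y, a, c, b⟩

lemma levA_bdd {r k : ℝ} {Φ : ℝ → ℝ} {S : ℝ → ℝ≥0∞} {ν : Measure ℝ} (H : Setup r k Φ S ν)
    {Ω : Set ℝ} (hΩ : IsOpen Ω) (hb : BddAbove Ω) (hb' : BddBelow Ω) {lam γ : ℝ} (hl : 0 < lam)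
    (hγ : 0 < γ) (hγk : γ ^ r * (2 * (2 * 4 ^ r * k)) ≤ 1) :
    ν (lev Φ Ω lam) ≤ ENNReal.ofReal (2 * (2 * 4 ^ r * k) * lam ^ (-r)) *
      volume (Ω ∩ {x | ENNReal.ofReal (γ * lam) ≤ S x}) := by
  have hr := H.hr
  have hk := H.hk
  set G : Set ℝ := {x | ENNReal.ofReal (γ * lam) ≤ S x} with hG
  have hGm : MeasurableSet G := measurableSet_le measurable_const H.hS
  set c := 2 * 4 ^ r * k * lam ^ (-r) with hc
  have hcpos : 0 < c := by positivity
  have key : ν (lev Φ Ω lam) ≤ (ENNReal.ofReal (2 * c) • volume.restrict G) (lev Φ Ω lam) := by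
    apply open_comp_le (lev_open H.hΦ hΩ) (hb.mono lev_subset) (hb'.mono lev_subset)
    intro α β hαβ hsub hβ
    have hrise : ∀ x ∈ Ioo α β, lam * (β - x) ≤ Φ β - Φ x := by
      intro x hx
      by_contra hcon
      push Not at hcon
      obtain ⟨z, hz, hzm⟩ := (isCompact_Icc (a := x) (b := β)).exists_isMaxOn
        (nonempty_Icc.2 hx.2.le) (f := fun t => Φ t - lam * t)
        (by have := H.hΦ; fun_prop)
      have hzm' : ∀ t ∈ Icc x β, Φ t - lam * t ≤ Φ z - lam * z := fun t ht => hzm ht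
      have h1 := hzm' x ⟨le_rfl, hx.2.le⟩
      have hzβ : z < β := by
        rcases hz.2.eq_or_lt with h | h
        · rw [h] at h1; nlinarith
        · exact h
      obtain ⟨y, hzy, hy, hF⟩ := hsub ⟨lt_of_lt_of_le hx.1 hz.1, hzβ⟩
      by_cases hyβ : y ≤ β
      · have := hzm' y ⟨hz.1.trans hzy.le, hyβ⟩
        nlinarith
      · push Not at hyβ
        exact hβ ⟨y, hyβ, (Icc_subset_Icc hzβ.le le_rfl).trans hy, by nlinarith⟩
    have h1 := comp_bound H.hΦ H.hm ν H.hr H.hk hl H.hA hαβ hrise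
    rw [← hc] at h1
    set C := Ioo α β with hC
    have hCm : MeasurableSet C := measurableSet_Ioo
    have hBm : MeasurableSet (C \ G) := hCm.diff hGm
    have h2 : ENNReal.ofReal ((γ * lam) ^ (-r)) * volume (C \ G) ≤ ν C := by
      calc ENNReal.ofReal ((γ * lam) ^ (-r)) * volume (C \ G)
          = ∫⁻ x in C \ G, ENNReal.ofReal ((γ * lam) ^ (-r)) := by simp
        _ ≤ ∫⁻ x in C \ G, S x ^ (-r) := by
          apply setLIntegral_mono' hBm
          intro x hx
          have hx2 : S x < ENNReal.ofReal (γ * lam) := not_le.1 hx.2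
          rw [← ENNReal.ofReal_rpow_of_pos (by positivity), ENNReal.rpow_neg, ENNReal.rpow_neg]
          gcongr
        _ = ν (C \ G) := by rw [H.hν, withDensity_apply _ hBm]
        _ ≤ ν C := measure_mono sdiff_subset
    have hCf : volume C ≠ ∞ := by simp [hC]
    have hBf : volume (C \ G) ≠ ∞ := ne_top_of_le_ne_top hCf (measure_mono sdiff_subset)
    have hGf : volume (G ∩ C) ≠ ∞ := ne_top_of_le_ne_top hCf (measure_mono inter_subset_right)
    have h3 : volume C = volume (G ∩ C) + volume (C \ G) := by
      rw [inter_comm, measure_inter_add_sdiff _ hGm]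
    have h4 := h2.trans h1
    rw [Measure.smul_apply, Measure.restrict_apply hCm, smul_eq_mul, inter_comm]
    refine h1.trans ?_
    obtain ⟨vC, hvC, hvC'⟩ : ∃ v : ℝ, 0 ≤ v ∧ volume C = ENNReal.ofReal v :=
      ⟨_, ENNReal.toReal_nonneg, (ENNReal.ofReal_toReal hCf).symm⟩
    obtain ⟨vB, hvB, hvB'⟩ : ∃ v : ℝ, 0 ≤ v ∧ volume (C \ G) = ENNReal.ofReal v :=
      ⟨_, ENNReal.toReal_nonneg, (ENNReal.ofReal_toReal hBf).symm⟩
    obtain ⟨vG, hvG, hvG'⟩ : ∃ v : ℝ, 0 ≤ v ∧ volume (G ∩ C) = ENNReal.ofReal v :=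
      ⟨_, ENNReal.toReal_nonneg, (ENNReal.ofReal_toReal hGf).symm⟩
    rw [hvC', hvB', hvG', ← ENNReal.ofReal_add hvG hvB,
      ENNReal.ofReal_eq_ofReal_iff hvC (by positivity)] at h3
    rw [hvB', hvC', ← ENNReal.ofReal_mul (by positivity), ← ENNReal.ofReal_mul (by positivity),
      ENNReal.ofReal_le_ofReal_iff (by positivity)] at h4
    rw [hvC', hvG', ← ENNReal.ofReal_mul (by positivity), ← ENNReal.ofReal_mul (by positivity)]
    apply ENNReal.ofReal_le_ofReal
    have h5 : vB ≤ γ ^ r * (2 * 4 ^ r * k) * vC := by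
      rw [Real.rpow_neg (by positivity), Real.mul_rpow hγ.le hl.le, hc, Real.rpow_neg hl.le] at h4
      have e1 : 0 < γ ^ r := by positivity
      have e2 : 0 < lam ^ r := by positivity
      have e3 := mul_le_mul_of_nonneg_left h4 (mul_pos e1 e2).le
      have e4 : γ ^ r * lam ^ r * ((γ ^ r * lam ^ r)⁻¹ * vB) = vB := by field_simp
      have e5 : γ ^ r * lam ^ r * (2 * 4 ^ r * k * (lam ^ r)⁻¹ * vC) = γ ^ r * (2 * 4 ^ r * k) * vC := by
        field_simp
      rw [e4, e5] at e3
      exact e3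
    have h6 : vC ≤ 2 * vG := by nlinarith
    nlinarith
  refine key.trans ?_
  rw [Measure.smul_apply, Measure.restrict_apply (lev_open H.hΦ hΩ).measurableSet, smul_eq_mul]
  have : 2 * c = 2 * (2 * 4 ^ r * k) * lam ^ (-r) := by rw [hc]; ring
  rw [this]
  gcongr
  exact lev_subset

lemma levA {r k : ℝ} {Φ : ℝ → ℝ} {S : ℝ → ℝ≥0∞} {ν : Measure ℝ} (H : Setup r k Φ S ν)
    {Ω : Set ℝ} (hΩ : IsOpen Ω) {lam γ : ℝ} (hl : 0 < lam)
    (hγ : 0 < γ) (hγk : γ ^ r * (2 * (2 * 4 ^ r * k)) ≤ 1) :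
    ν (lev Φ Ω lam) ≤ ENNReal.ofReal (2 * (2 * 4 ^ r * k) * lam ^ (-r)) *
      volume (Ω ∩ {x | ENNReal.ofReal (γ * lam) ≤ S x}) := by
  have hU : lev Φ Ω lam = ⋃ n : ℕ, lev Φ (Ω ∩ Ioo (-(n:ℝ)) n) lam := by
    ext x
    simp only [mem_iUnion]
    constructor
    · rintro ⟨y, hxy, hy, hF⟩
      obtain ⟨n, hn⟩ := exists_nat_gt (max |x| |y|)
      have h1 := abs_lt.1 ((le_max_left _ _).trans_lt hn)
      have h2 := abs_lt.1 ((le_max_right _ _).trans_lt hn)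
      exact ⟨n, y, hxy, fun z hz => ⟨hy hz, by linarith [hz.1], by linarith [hz.2]⟩, hF⟩
    · rintro ⟨n, y, hxy, hy, hF⟩
      exact ⟨y, hxy, hy.trans inter_subset_left, hF⟩
  have hmon : Monotone (fun n : ℕ => lev Φ (Ω ∩ Ioo (-(n:ℝ)) n) lam) := by
    rintro n m hnm x ⟨y, hxy, hy, hF⟩
    have : (n:ℝ) ≤ m := by exact_mod_cast hnm
    exact ⟨y, hxy, hy.trans (inter_subset_inter_right _ (Ioo_subset_Ioo (by linarith) this)), hF⟩
  rw [hU, hmon.measure_iUnion]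
  apply iSup_le
  intro n
  refine (levA_bdd H (hΩ.inter isOpen_Ioo) (bddAbove_Ioo.mono inter_subset_right)
    (bddBelow_Ioo.mono inter_subset_right) hl hγ hγk).trans ?_
  gcongr
  exact inter_subset_left

def ed (m : ℤ) : ℝ≥0∞ := ENNReal.ofReal ((2:ℝ) ^ m)

lemma ed_pos (m : ℤ) : (0:ℝ) < (2:ℝ) ^ m := zpow_pos (by norm_num) m

lemma ed_succ (m : ℤ) : ed (m + 1) = 2 * ed m := by
  unfold ed
  rw [zpow_add₀ (by norm_num), zpow_one, mul_comm, ENNReal.ofReal_mul (by norm_num)]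
  simp

lemma ed_ne_top (m : ℤ) : ed m ≠ ∞ := ENNReal.ofReal_ne_top
lemma ed_ne_zero (m : ℤ) : ed m ≠ 0 := by
  unfold ed; simpa using ed_pos m

lemma ed_exists {y : ℝ≥0∞} (h0 : y ≠ 0) (ht : y ≠ ∞) : ∃ m : ℤ, ed m < y ∧ y ≤ ed (m + 1) := by
  obtain ⟨m, hm⟩ := exists_mem_Ioc_zpow (x := y.toReal) (y := (2:ℝ)) (ENNReal.toReal_pos h0 ht)
    (by norm_num)
  refine ⟨m, ?_, ?_⟩
  · unfold ed
    rw [ENNReal.ofReal_lt_iff_lt_toReal (ed_pos m).le ht]; exact hm.1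
  · unfold ed
    rw [ENNReal.le_ofReal_iff_toReal_le ht (ed_pos _).le]; exact hm.2

lemma ed_unbdd (a : ℝ≥0∞) (ha : a ≠ ∞) : ∃ m : ℤ, a ≤ ed m := by
  obtain ⟨n, hn⟩ := pow_unbounded_of_one_lt a.toReal (y := (2:ℝ)) (by norm_num)
  refine ⟨n, ?_⟩
  unfold ed
  rw [ENNReal.le_ofReal_iff_toReal_le ha (ed_pos _).le]
  exact_mod_cast hn.le

lemma dy1 {s : ℝ} (hs : 0 < s) (y : ℝ≥0∞) :
    y ^ s ≤ ∑' m : ℤ, {z : ℝ≥0∞ | ed m < z}.indicator (fun _ => ed (m + 1) ^ s) y := by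
  by_cases h0 : y = 0
  · simp [h0, hs]
  by_cases ht : y = ∞
  · subst ht
    have : ∑' m : ℤ, {z : ℝ≥0∞ | ed m < z}.indicator (fun _ => ed (m + 1) ^ s) ∞ = ∞ := by
      apply ENNReal.eq_top_of_forall_nnreal_le
      intro a
      obtain ⟨m, hm⟩ := ed_unbdd ((a : ℝ≥0∞) ^ (1 / s)) (by simp [hs.le])
      refine le_trans ?_ (ENNReal.le_tsum (m - 1))
      rw [indicator_of_mem (by simpa using (ed_ne_top (m-1)).lt_top), sub_add_cancel]
      calc (a : ℝ≥0∞) = ((a : ℝ≥0∞) ^ (1 / s)) ^ s := by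
            rw [← ENNReal.rpow_mul, one_div_mul_cancel hs.ne', ENNReal.rpow_one]
        _ ≤ _ := by gcongr
    rw [this]; exact le_top
  obtain ⟨m, hm1, hm2⟩ := ed_exists h0 ht
  refine le_trans ?_ (ENNReal.le_tsum m)
  rw [indicator_of_mem (by exact hm1)]
  gcongr

lemma dy2 {s : ℝ} (hs : 0 < s) : ∃ C : ℝ≥0∞, C ≠ ∞ ∧ ∀ y : ℝ≥0∞,
    ∑' m : ℤ, {z : ℝ≥0∞ | ed m ≤ z}.indicator (fun _ => ed m ^ s) y ≤ C * y ^ s := by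
  have hlt : ENNReal.ofReal ((1/2:ℝ) ^ s) < 1 := by
    rw [ENNReal.ofReal_lt_one]
    exact Real.rpow_lt_one (by norm_num) (by norm_num) hs
  refine ⟨(1 - ENNReal.ofReal ((1/2:ℝ) ^ s))⁻¹, ?_, ?_⟩
  · rw [ENNReal.inv_ne_top]
    exact (tsub_pos_of_lt hlt).ne'
  intro y
  by_cases h0 : y = 0
  · have : ∑' m : ℤ, {z : ℝ≥0∞ | ed m ≤ z}.indicator (fun _ => ed m ^ s) y = 0 := by
      rw [ENNReal.tsum_eq_zero]
      intro m
      rw [indicator_of_notMem]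
      simpa [h0] using ed_ne_zero m
    rw [this]; exact zero_le
  by_cases ht : y = ∞
  · rw [ht, ENNReal.top_rpow_of_pos hs, ENNReal.mul_top]
    · exact le_top
    · simp
  obtain ⟨m0, hm1, hm2⟩ := exists_mem_Ico_zpow (x := y.toReal) (y := (2:ℝ)) (ENNReal.toReal_pos h0 ht)
    (by norm_num)
  have hinj : Function.Injective (fun n : ℕ => m0 - (n:ℤ)) := by
    intro a b hab; simp only at hab; omega
  have hsupp : Function.support (fun m : ℤ => {z : ℝ≥0∞ | ed m ≤ z}.indicator (fun _ => ed m ^ s) y)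
      ⊆ range (fun n : ℕ => m0 - (n:ℤ)) := by
    intro m hm
    have h1 : ed m ≤ y := by
      by_contra hcon
      exact hm (indicator_of_notMem (by exact hcon) _)
    unfold ed at h1
    rw [ENNReal.ofReal_le_iff_le_toReal ht] at h1
    have h2 := (zpow_lt_zpow_iff_right₀ (by norm_num : (1:ℝ) < 2)).1 (lt_of_le_of_lt h1 hm2)
    exact ⟨(m0 - m).toNat, by simp only; omega⟩
  rw [← hinj.tsum_eq hsupp]
  have hy0 : ed m0 ≤ y := by
    unfold ed; rw [ENNReal.ofReal_le_iff_le_toReal ht]; exact hm1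
  calc ∑' n : ℕ, {z : ℝ≥0∞ | ed (m0 - n) ≤ z}.indicator (fun _ => ed (m0 - n) ^ s) y
      ≤ ∑' n : ℕ, ENNReal.ofReal ((1/2:ℝ) ^ s) ^ n * ed m0 ^ s := by
        apply ENNReal.tsum_le_tsum
        intro n
        refine (indicator_le_self _ _ _).trans (le_of_eq ?_)
        unfold ed
        rw [ENNReal.ofReal_rpow_of_pos (ed_pos _), ENNReal.ofReal_rpow_of_pos (ed_pos _),
          ← ENNReal.ofReal_pow (by positivity), ← ENNReal.ofReal_mul (by positivity)]
        congr 1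
        rw [zpow_sub₀ (by norm_num), Real.div_rpow (by positivity) (by positivity),
          ← Real.rpow_natCast, ← Real.rpow_mul (by norm_num), mul_comm s, Real.rpow_mul (by norm_num),
          Real.rpow_natCast, one_div, inv_pow, Real.inv_rpow (by positivity), zpow_natCast]
        field_simp
    _ = (1 - ENNReal.ofReal ((1/2:ℝ) ^ s))⁻¹ * ed m0 ^ s := by
        rw [ENNReal.tsum_mul_right, ENNReal.tsum_geometric]
    _ ≤ _ := by gcongr

def MO (Φ : ℝ → ℝ) (Ω : Set ℝ) (x : ℝ) : ℝ≥0∞ :=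
  ⨆ (y : ℝ) (_ : x < y) (_ : Icc x y ⊆ Ω), ENNReal.ofReal ((Φ y - Φ x) / (y - x))

lemma MO_lt {Φ : ℝ → ℝ} {Ω : Set ℝ} {x : ℝ} {m : ℤ} (h : ed m < MO Φ Ω x) :
    x ∈ lev Φ Ω ((2:ℝ) ^ m) := by
  unfold MO at h
  simp only [lt_iSup_iff] at h
  obtain ⟨y, hxy, hy, hlt⟩ := h
  refine ⟨y, hxy, hy, ?_⟩
  unfold ed at hlt
  have := (ENNReal.ofReal_lt_ofReal_iff_of_nonneg (ed_pos m).le).1 hlt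
  rwa [lt_div_iff₀ (sub_pos.2 hxy)] at this

lemma testing {r : ℝ} (hr : 0 < r) : ∃ C : ℝ≥0∞, C ≠ ∞ ∧ ∀ (k : ℝ) (Φ : ℝ → ℝ) (S : ℝ → ℝ≥0∞)
    (ν : Measure ℝ), Setup r k Φ S ν → ∀ Ω : Set ℝ, IsOpen Ω →
    ∫⁻ x, MO Φ Ω x ^ (r + 1) ∂ν ≤ C * ENNReal.ofReal (k ^ (1 + 1 / r)) * ∫⁻ x in Ω, S x := by
  obtain ⟨C1, hC1, hdy⟩ := dy2 (s := 1) one_pos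
  refine ⟨ENNReal.ofReal (2 ^ (r+1) * (4 * 4 ^ r) * (4 * 4 ^ r) ^ (1/r)) * C1,
    ENNReal.mul_ne_top ENNReal.ofReal_ne_top hC1, ?_⟩
  intro k Φ S ν H Ω hΩ
  have hk := H.hk
  set q := 4 * 4 ^ r * k with hq
  have hqpos : 0 < q := by positivity
  set γ := q ^ (-(1/r)) with hγdef
  have hγ : 0 < γ := by positivity
  have hγk : γ ^ r * (2 * (2 * 4 ^ r * k)) ≤ 1 := by
    rw [hγdef, ← Real.rpow_mul hqpos.le]
    have e1 : -(1/r) * r = -1 := by field_simp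
    have e2 : 2 * (2 * 4 ^ r * k) = q := by rw [hq]; ring
    rw [e1, e2, Real.rpow_neg_one, inv_mul_cancel₀ hqpos.ne']
  have hlm : ∀ m : ℤ, MeasurableSet (lev Φ Ω ((2:ℝ)^m)) := fun m => (lev_open H.hΦ hΩ).measurableSet
  have hterm : ∀ m : ℤ, ed (m+1) ^ (r+1) * ν (lev Φ Ω ((2:ℝ)^m)) ≤
      ENNReal.ofReal (2 ^ (r+1) * q) * ∫⁻ x in Ω,
        {z : ℝ≥0∞ | ed m ≤ z}.indicator (fun _ => ed m ^ (1:ℝ)) (ENNReal.ofReal γ⁻¹ * S x) := by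
    intro m
    have h1 := levA H hΩ (ed_pos m) hγ hγk
    have hset : MeasurableSet {x | ENNReal.ofReal (γ * 2 ^ m) ≤ S x} :=
      measurableSet_le measurable_const H.hS
    have h2 : ∫⁻ x in Ω,
        {z : ℝ≥0∞ | ed m ≤ z}.indicator (fun _ => ed m ^ (1:ℝ)) (ENNReal.ofReal γ⁻¹ * S x) =
        ed m * volume (Ω ∩ {x | ENNReal.ofReal (γ * 2 ^ m) ≤ S x}) := by
      have : ∀ x, {z : ℝ≥0∞ | ed m ≤ z}.indicator (fun _ => ed m ^ (1:ℝ)) (ENNReal.ofReal γ⁻¹ * S x)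
          = {x | ENNReal.ofReal (γ * 2 ^ m) ≤ S x}.indicator (fun _ => ed m) x := by
        intro x
        have hiff : ed m ≤ ENNReal.ofReal γ⁻¹ * S x ↔ ENNReal.ofReal (γ * 2 ^ m) ≤ S x := by
          unfold ed
          rw [ENNReal.ofReal_inv_of_pos hγ, ENNReal.ofReal_mul hγ.le,
            ENNReal.mul_le_iff_le_inv (by simpa using hγ) (by simp)]
        by_cases h : ed m ≤ ENNReal.ofReal γ⁻¹ * S x
        · rw [indicator_of_mem (by exact h), indicator_of_mem (by exact hiff.1 h), ENNReal.rpow_one]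
        · rw [indicator_of_notMem (by exact h), indicator_of_notMem (by exact fun h' => h (hiff.2 h'))]
      simp_rw [this]
      rw [lintegral_indicator hset, setLIntegral_const, Measure.restrict_apply hset, inter_comm]
    rw [h2]
    calc _ ≤ ed (m+1) ^ (r+1) * (ENNReal.ofReal (2 * (2 * 4 ^ r * k) * ((2:ℝ)^m) ^ (-r)) *
          volume (Ω ∩ {x | ENNReal.ofReal (γ * 2 ^ m) ≤ S x})) := by gcongr
      _ = _ := by
        rw [← mul_assoc (ed (m+1) ^ (r+1)), ← mul_assoc (ENNReal.ofReal (2 ^ (r+1) * q))]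
        congr 1
        rw [ed_succ, ENNReal.mul_rpow_of_nonneg _ _ (by positivity)]
        unfold ed
        have hp := ed_pos m
        rw [ENNReal.ofReal_rpow_of_pos hp, ← ENNReal.ofReal_ofNat 2,
          ENNReal.ofReal_rpow_of_pos (by norm_num), ← ENNReal.ofReal_mul (by positivity),
          ← ENNReal.ofReal_mul (by positivity), ← ENNReal.ofReal_mul (by positivity)]
        congr 1
        rw [Real.rpow_add hp, Real.rpow_one, Real.rpow_neg hp.le, hq]
        have : ((2:ℝ)^m)^r ≠ 0 := by positivity
        field_simp
        ring
  calc ∫⁻ x, MO Φ Ω x ^ (r + 1) ∂ν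
      ≤ ∫⁻ x, ∑' m : ℤ, (lev Φ Ω ((2:ℝ)^m)).indicator (fun _ => ed (m+1) ^ (r+1)) x ∂ν := by
        apply lintegral_mono
        intro x
        refine (dy1 (by positivity) _).trans ?_
        apply ENNReal.tsum_le_tsum
        intro m
        by_cases h : ed m < MO Φ Ω x
        · rw [indicator_of_mem (by exact h), indicator_of_mem (MO_lt h)]
        · rw [indicator_of_notMem (by exact h)]; exact zero_le
    _ = ∑' m : ℤ, ed (m+1) ^ (r+1) * ν (lev Φ Ω ((2:ℝ)^m)) := by
        rw [lintegral_tsum (fun m => (measurable_const.indicator (hlm m)).aemeasurable)]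
        congr 1; ext m
        rw [lintegral_indicator (hlm m), setLIntegral_const]
    _ ≤ ∑' m : ℤ, ENNReal.ofReal (2 ^ (r+1) * q) * ∫⁻ x in Ω,
        {z : ℝ≥0∞ | ed m ≤ z}.indicator (fun _ => ed m ^ (1:ℝ)) (ENNReal.ofReal γ⁻¹ * S x) :=
        ENNReal.tsum_le_tsum hterm
    _ = ENNReal.ofReal (2 ^ (r+1) * q) * ∫⁻ x in Ω, ∑' m : ℤ,
        {z : ℝ≥0∞ | ed m ≤ z}.indicator (fun _ => ed m ^ (1:ℝ)) (ENNReal.ofReal γ⁻¹ * S x) := by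
        rw [ENNReal.tsum_mul_left, lintegral_tsum]
        intro m
        have : Measurable ({z : ℝ≥0∞ | ed m ≤ z}.indicator (fun _ => ed m ^ (1:ℝ))) :=
          measurable_const.indicator measurableSet_Ici
        exact (this.comp (H.hS.const_mul _)).aemeasurable
    _ ≤ ENNReal.ofReal (2 ^ (r+1) * q) * ∫⁻ x in Ω, C1 * (ENNReal.ofReal γ⁻¹ * S x) := by
        gcongr with x
        refine (hdy _).trans ?_
        rw [ENNReal.rpow_one]
    _ = _ := by
        rw [lintegral_const_mul _ (H.hS.const_mul _), lintegral_const_mul _ H.hS]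
        have e : γ⁻¹ = (4 * 4 ^ r) ^ (1/r) * k ^ (1/r) := by
          rw [hγdef, Real.rpow_neg hqpos.le, inv_inv, hq, Real.mul_rpow (by positivity) hk.le]
        have e2 : ENNReal.ofReal (2 ^ (r+1) * q) * ENNReal.ofReal γ⁻¹ =
          ENNReal.ofReal (2 ^ (r+1) * (4 * 4 ^ r) * (4 * 4 ^ r) ^ (1/r)) *
            ENNReal.ofReal (k ^ (1 + 1 / r)) := by
          rw [← ENNReal.ofReal_mul (by positivity), ← ENNReal.ofReal_mul (by positivity), e,
            Real.rpow_add hk, Real.rpow_one, hq]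
          congr 1; ring
        calc _ = (ENNReal.ofReal (2 ^ (r+1) * q) * ENNReal.ofReal γ⁻¹) * C1 * ∫⁻ x in Ω, S x := by ring
          _ = _ := by rw [e2]; ring

lemma cover_fin {ι : Type*} (c d : ι → ℝ) (μ ρ : Measure ℝ) (t : ℝ≥0∞)
    (h : ∀ i, t * μ (Ioo (c i) (d i)) ≤ ρ (Ioo (c i) (d i))) (n : ℕ) :
    ∀ F : Finset ι, F.card = n → t * μ (⋃ i ∈ F, Ioo (c i) (d i)) ≤ 2 * ρ univ := by
  classical
  induction n with
  | zero =>
    intro F hF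
    rw [Finset.card_eq_zero] at hF
    simp [hF]
  | succ n ih =>
    intro F hF
    by_cases hred : ∃ i ∈ F, Ioo (c i) (d i) ⊆ ⋃ j ∈ F.erase i, Ioo (c j) (d j)
    · obtain ⟨i, hi, hsub⟩ := hred
      have := ih (F.erase i) (by rw [Finset.card_erase_of_mem hi, hF]; rfl)
      refine le_trans ?_ this
      refine mul_le_mul_right (measure_mono ?_) t
      apply iUnion₂_subset
      intro j hj
      by_cases hji : j = i
      · subst hji; exact hsub
      · exact subset_biUnion_of_mem (u := fun j => Ioo (c j) (d j))
          (show j ∈ ((F.erase i : Finset ι) : Set ι) by simp [hji, hj])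
    · push Not at hred
      have hov : ∀ x, ∑ i ∈ F, (Ioo (c i) (d i)).indicator (fun _ => (1:ℝ≥0∞)) x ≤ 2 := by
        intro x
        have hsum : ∑ i ∈ F, (Ioo (c i) (d i)).indicator (fun _ => (1:ℝ≥0∞)) x =
            ((F.filter (fun i => x ∈ Ioo (c i) (d i))).card : ℝ≥0∞) := by
          simp [indicator_apply]
        rw [hsum]
        set Fx := F.filter (fun i => x ∈ Ioo (c i) (d i)) with hFx
        have : Fx.card ≤ 2 := by
          by_contra hcon
          push Not at hcon
          have hne : Fx.Nonempty := Finset.card_pos.1 (by omega)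
          obtain ⟨a, ha, hamin⟩ := Finset.exists_min_image Fx c hne
          obtain ⟨b, hb, hbmax⟩ := Finset.exists_max_image Fx d hne
          obtain ⟨i, hi, hi'⟩ := Finset.exists_mem_notMem_of_card_lt_card
            (s := ({a, b} : Finset ι)) (t := Fx) (lt_of_le_of_lt Finset.card_le_two hcon)
          simp only [Finset.mem_insert, Finset.mem_singleton, not_or] at hi'
          have hiF := (Finset.mem_filter.1 hi)
          have haF := (Finset.mem_filter.1 ha)
          have hbF := (Finset.mem_filter.1 hb)
          apply hred i hiF.1
          intro z hz
          simp only [mem_iUnion]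
          by_cases hzx : z ≤ x
          · exact ⟨a, Finset.mem_erase.2 ⟨Ne.symm hi'.1, haF.1⟩,
              lt_of_le_of_lt (hamin i hi) hz.1, lt_of_le_of_lt hzx haF.2.2⟩
          · push Not at hzx
            exact ⟨b, Finset.mem_erase.2 ⟨Ne.symm hi'.2, hbF.1⟩,
              hbF.2.1.trans hzx, lt_of_lt_of_le hz.2 (hbmax i hi)⟩
        exact_mod_cast this
      calc t * μ (⋃ i ∈ F, Ioo (c i) (d i)) ≤ t * ∑ i ∈ F, μ (Ioo (c i) (d i)) := by
            gcongr; exact measure_biUnion_finset_le _ _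
        _ = ∑ i ∈ F, t * μ (Ioo (c i) (d i)) := Finset.mul_sum _ _ _
        _ ≤ ∑ i ∈ F, ρ (Ioo (c i) (d i)) := Finset.sum_le_sum fun i _ => h i
        _ = ∑ i ∈ F, ∫⁻ x, (Ioo (c i) (d i)).indicator (fun _ => (1:ℝ≥0∞)) x ∂ρ := by
            apply Finset.sum_congr rfl
            intro i _
            rw [lintegral_indicator measurableSet_Ioo]; simp
        _ = ∫⁻ x, ∑ i ∈ F, (Ioo (c i) (d i)).indicator (fun _ => (1:ℝ≥0∞)) x ∂ρ := by
            rw [lintegral_finsetSum]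
            intro i _
            exact measurable_const.indicator measurableSet_Ioo
        _ ≤ ∫⁻ x, 2 ∂ρ := lintegral_mono hov
        _ = _ := by simp

lemma cover_all {ι : Type*} (c d : ι → ℝ) (μ ρ : Measure ℝ) (t : ℝ≥0∞)
    (h : ∀ i, t * μ (Ioo (c i) (d i)) ≤ ρ (Ioo (c i) (d i))) :
    t * μ (⋃ i, Ioo (c i) (d i)) ≤ 2 * ρ univ := by
  classical
  obtain ⟨T, hT, hU⟩ := TopologicalSpace.isOpen_iUnion_countable (fun i => Ioo (c i) (d i))
    (fun i => isOpen_Ioo)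
  rw [← hU]
  have : Countable T := hT
  have e : (⋃ i ∈ T, Ioo (c i) (d i)) = ⋃ F : Finset T, ⋃ i ∈ F, Ioo (c i) (d i) := by
    ext x
    simp only [mem_iUnion]
    constructor
    · rintro ⟨i, hi, hx⟩
      exact ⟨{⟨i, hi⟩}, ⟨i, hi⟩, by simp, hx⟩
    · rintro ⟨F, i, hi, hx⟩
      exact ⟨i, i.2, hx⟩
  have hdir : Directed (· ⊆ ·) (fun F : Finset T => ⋃ i ∈ F, Ioo (c i) (d i)) := by
    apply Monotone.directed_le
    intro F G hFG
    exact biUnion_subset_biUnion_left (fun i hi => hFG hi)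
  rw [e, hdir.measure_iUnion, ENNReal.mul_iSup]
  apply iSup_le
  intro F
  exact cover_fin (fun i : T => c i) (fun i : T => d i) μ ρ t (fun i => h i) _ F rfl

def Om (S g : ℝ → ℝ≥0∞) (t : ℝ≥0∞) : Set ℝ :=
  ⋃ p : {p : ℝ × ℝ // t * (∫⁻ x in Ioo p.1 p.2, S x) < ∫⁻ x in Ioo p.1 p.2, g x * S x},
    Ioo p.1.1 p.1.2

lemma Om_open (S g : ℝ → ℝ≥0∞) (t : ℝ≥0∞) : IsOpen (Om S g t) :=
  isOpen_iUnion fun _ => isOpen_Ioo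

lemma Om_weak {r k : ℝ} {Φ : ℝ → ℝ} {S : ℝ → ℝ≥0∞} {ν : Measure ℝ} (H : Setup r k Φ S ν)
    {g : ℝ → ℝ≥0∞} (hg : Measurable g) (i : ℤ) :
    ed i * ∫⁻ x in Om S g (ed (i+1)), S x ≤
      2 * ∫⁻ x, {z | ed i ≤ z}.indicator id (g x) * S x := by
  have hS := H.hS
  have hind : Measurable ({z | ed i ≤ z}.indicator (id : ℝ≥0∞ → ℝ≥0∞)) :=
    measurable_id.indicator measurableSet_Ici
  have hm : Measurable (fun x => {z | ed i ≤ z}.indicator id (g x) * S x) :=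
    (hind.comp hg).mul hS
  have := cover_all
    (ι := {p : ℝ × ℝ // ed (i+1) * (∫⁻ x in Ioo p.1 p.2, S x) < ∫⁻ x in Ioo p.1 p.2, g x * S x})
    (fun p => p.1.1) (fun p => p.1.2) (volume.withDensity S)
    (volume.withDensity (fun x => {z | ed i ≤ z}.indicator id (g x) * S x)) (ed i) ?_
  · rw [withDensity_apply _ MeasurableSet.univ, setLIntegral_univ] at this
    have h2 := withDensity_apply (μ := volume) S (Om_open S g (ed (i+1))).measurableSet
    rw [← h2]
    exact this
  · rintro ⟨⟨c, d⟩, hp⟩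
    simp only at hp ⊢
    rw [withDensity_apply _ measurableSet_Ioo, withDensity_apply _ measurableSet_Ioo]
    by_cases hcd : c < d
    swap
    · simp [Ioo_eq_empty hcd]
    have hfin : ∫⁻ x in Ioo c d, S x ≠ ∞ := by
      apply ne_top_of_le_ne_top (b := ∫⁻ x in Ioc c d, S x)
      · rw [H.hμ c d hcd.le]; simp
      · exact lintegral_mono_set Ioo_subset_Ioc_self
    have h1 : ∫⁻ x in Ioo c d, g x * S x ≤
        ∫⁻ x in Ioo c d, ({z | ed i ≤ z}.indicator id (g x) * S x + ed i * S x) := by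
      apply lintegral_mono
      intro x
      show g x * S x ≤ {z | ed i ≤ z}.indicator id (g x) * S x + ed i * S x
      rw [← add_mul]
      gcongr
      by_cases hx : ed i ≤ g x
      · rw [indicator_of_mem (by exact hx)]; exact le_self_add
      · exact (not_le.1 hx).le.trans le_add_self
    rw [lintegral_add_left hm, lintegral_const_mul _ hS] at h1
    have h2 := hp.le.trans h1
    rw [ed_succ, two_mul, add_mul] at h2
    exact (ENNReal.add_le_add_iff_right (ENNReal.mul_ne_top (ed_ne_top i) hfin)).1 h2

lemma ed_exists2 {A b : ℝ≥0∞} (h : b < A) : ∃ i : ℤ, ed (i+1) < A ∧ b ≤ ed (i+2) := by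
  by_cases hA : A = ∞
  · obtain ⟨m, hm⟩ := ed_unbdd b h.ne_top
    refine ⟨m - 2, by rw [hA]; exact (ed_ne_top _).lt_top, by simpa using hm⟩
  · obtain ⟨m, h1, h2⟩ := ed_exists (pos_of_gt h).ne' hA
    refine ⟨m - 1, by simpa using h1, ?_⟩
    have : m - 1 + 2 = m + 1 := by ring
    rw [this]; exact h.le.trans h2

def Mp (F : ℝ → ℝ≥0∞) (x : ℝ) : ℝ≥0∞ :=
  ⨆ (y : ℝ) (_ : x < y), ENNReal.ofReal ((y - x)⁻¹) * ∫⁻ t in Ioc x y, F t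

lemma Om_mem {r k : ℝ} {Φ : ℝ → ℝ} {S : ℝ → ℝ≥0∞} {ν : Measure ℝ} (H : Setup r k Φ S ν)
    {g : ℝ → ℝ≥0∞} (j : ℤ) {x y : ℝ} (hxy : x < y)
    (h : ed j * ENNReal.ofReal (Φ y - Φ x) < ∫⁻ t in Ioc x y, g t * S t) :
    Icc x y ⊆ Om S g (ed j) := by
  have hΦ := H.hΦ
  have hc : Continuous (fun ε : ℝ => ENNReal.ofReal ((2:ℝ)^j * (Φ (y + ε) - Φ (x - ε)))) :=
    ENNReal.continuous_ofReal.comp (by fun_prop)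
  have h0 : ENNReal.ofReal ((2:ℝ)^j * (Φ (y + 0) - Φ (x - 0))) < ∫⁻ t in Ioc x y, g t * S t := by
    rw [ENNReal.ofReal_mul (ed_pos j).le, add_zero, sub_zero]; exact h
  have hev : ∀ᶠ ε in nhdsWithin (0:ℝ) (Ioi 0),
      ENNReal.ofReal ((2:ℝ)^j * (Φ (y + ε) - Φ (x - ε))) < ∫⁻ t in Ioc x y, g t * S t :=
    nhdsWithin_le_nhds ((hc.tendsto 0).eventually (gt_mem_nhds h0))
  obtain ⟨ε, hε, hεpos⟩ := (hev.and self_mem_nhdsWithin).exists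
  have hεpos : 0 < ε := hεpos
  intro z hz
  refine mem_iUnion.2 ⟨⟨(x - ε, y + ε), ?_⟩, ?_⟩
  · calc ed j * ∫⁻ t in Ioo (x - ε) (y + ε), S t ≤ ed j * ∫⁻ t in Ioc (x - ε) (y + ε), S t := by
          gcongr; exact Ioo_subset_Ioc_self
      _ = ENNReal.ofReal ((2:ℝ)^j * (Φ (y + ε) - Φ (x - ε))) := by
          rw [H.hμ _ _ (by linarith), ENNReal.ofReal_mul (ed_pos j).le]; rfl
      _ < _ := hε
      _ ≤ _ := by
          apply lintegral_mono_set
          intro z hz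
          exact ⟨by linarith [hz.1], by linarith [hz.2]⟩
  · exact ⟨by simp only; linarith [hz.1], by simp only; linarith [hz.2]⟩

lemma Mp_le {r k : ℝ} {Φ : ℝ → ℝ} {S : ℝ → ℝ≥0∞} {ν : Measure ℝ} (H : Setup r k Φ S ν)
    {g : ℝ → ℝ≥0∞} {s : ℝ} (hs : 0 < s) (x : ℝ) :
    Mp (fun t => g t * S t) x ^ s ≤
      ∑' i : ℤ, (ed (i+2) * MO Φ (Om S g (ed (i+1))) x) ^ s := by
  set R := ∑' i : ℤ, (ed (i+2) * MO Φ (Om S g (ed (i+1))) x) ^ s with hR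
  rw [← ENNReal.le_rpow_inv_iff hs]
  apply iSup₂_le
  intro y hxy
  have hm : 0 < Φ y - Φ x := sub_pos.2 (H.hm hxy)
  have hd : 0 < y - x := sub_pos.2 hxy
  set I := ∫⁻ t in Ioc x y, g t * S t with hI
  set c0 := ENNReal.ofReal ((Φ y - Φ x) / (y - x)) with hc0
  have hc0pos : 0 < c0 := by rw [hc0, ENNReal.ofReal_pos]; positivity
  set mm := ENNReal.ofReal (Φ y - Φ x) with hmm
  have hmm0 : mm ≠ 0 := by simpa [hmm] using H.hm hxy
  have hmmt : mm ≠ ∞ := by simp [hmm]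
  have e : ENNReal.ofReal ((y - x)⁻¹) * I = (I / mm) * c0 := by
    have e1 : c0 = mm * ENNReal.ofReal ((y-x)⁻¹) := by
      rw [hc0, div_eq_mul_inv, ENNReal.ofReal_mul hm.le]
    rw [e1, ← mul_assoc, ENNReal.div_mul_cancel hmm0 hmmt, mul_comm]
  rw [e, ← ENNReal.le_div_iff_mul_le (by left; exact hc0pos.ne') (by left; simp [hc0])]
  apply le_of_forall_lt
  intro b hb
  obtain ⟨b', hbb', hb'⟩ := exists_between hb
  refine lt_of_lt_of_le hbb' ?_
  obtain ⟨i, h1, h2⟩ := ed_exists2 hb'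
  rw [ENNReal.le_div_iff_mul_le (by left; exact hc0pos.ne') (by left; simp [hc0]),
    ENNReal.le_rpow_inv_iff hs]
  refine le_trans ?_ (ENNReal.le_tsum i)
  gcongr
  rw [ENNReal.lt_div_iff_mul_lt (by left; exact hmm0) (by left; exact hmmt)] at h1
  have hsub := Om_mem H (i+1) hxy h1
  unfold MO
  exact le_iSup_of_le y (le_iSup_of_le hxy (le_iSup_of_le hsub le_rfl))

lemma MO_meas {r k : ℝ} {Φ : ℝ → ℝ} {S : ℝ → ℝ≥0∞} {ν : Measure ℝ} (H : Setup r k Φ S ν)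
    {Ω : Set ℝ} (hΩ : IsOpen Ω) : Measurable (MO Φ Ω) := by
  apply measurable_of_Ioi
  intro a
  by_cases ha : a = ∞
  · simp [ha]
  have : MO Φ Ω ⁻¹' Ioi a = lev Φ Ω a.toReal := by
    ext x
    simp only [mem_preimage, mem_Ioi, MO, lt_iSup_iff, lev, mem_ofPred_eq]
    apply exists_congr
    intro y
    constructor
    · rintro ⟨hxy, hy, h⟩
      refine ⟨hxy, hy, ?_⟩
      rw [← lt_div_iff₀ (sub_pos.2 hxy)]
      exact (ENNReal.lt_ofReal_iff_toReal_lt ha).1 h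
    · rintro ⟨hxy, hy, h⟩
      refine ⟨hxy, hy, ?_⟩
      rw [← lt_div_iff₀ (sub_pos.2 hxy)] at h
      exact (ENNReal.lt_ofReal_iff_toReal_lt ha).2 h
  rw [this]
  exact (lev_open H.hΦ hΩ).measurableSet

theorem core {r : ℝ} (hr : 0 < r) : ∃ C : ℝ≥0∞, C ≠ ∞ ∧ ∀ (k : ℝ) (Φ : ℝ → ℝ) (S : ℝ → ℝ≥0∞)
    (ν : Measure ℝ), Setup r k Φ S ν → ∀ g : ℝ → ℝ≥0∞, Measurable g →
    ∫⁻ x, Mp (fun t => g t * S t) x ^ (r + 1) ∂ν ≤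
      C * ENNReal.ofReal (k ^ (1 + 1 / r)) * ∫⁻ x, g x ^ (r + 1) * S x := by
  obtain ⟨C1, hC1, htest⟩ := testing hr
  obtain ⟨C2, hC2, hdy⟩ := dy2 hr
  refine ⟨4 ^ (r+1) * C1 * 2 * C2, ?_, ?_⟩
  · refine ENNReal.mul_ne_top (ENNReal.mul_ne_top (ENNReal.mul_ne_top ?_ hC1) (by simp)) hC2
    exact ENNReal.rpow_ne_top_of_nonneg (by positivity) (by simp)
  intro k Φ S ν H g hg
  set kk := ENNReal.ofReal (k ^ (1 + 1 / r)) with hkk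
  have hS := H.hS
  have hs : 0 < r + 1 := by positivity
  have hed : ∀ i : ℤ, ed (i+2) = 4 * ed i := by
    intro i
    have : i + 2 = (i + 1) + 1 := by ring
    rw [this, ed_succ, ed_succ, ← mul_assoc]; norm_num
  have hindm : ∀ i : ℤ, Measurable (fun x => {z | ed i ≤ z}.indicator id (g x) * S x) := by
    intro i
    have hind : Measurable ({z | ed i ≤ z}.indicator (id : ℝ≥0∞ → ℝ≥0∞)) :=
      measurable_id.indicator measurableSet_Ici
    exact (hind.comp hg).mul hS
  calc ∫⁻ x, Mp (fun t => g t * S t) x ^ (r + 1) ∂ν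
      ≤ ∫⁻ x, ∑' i : ℤ, (ed (i+2) * MO Φ (Om S g (ed (i+1))) x) ^ (r+1) ∂ν :=
        lintegral_mono fun x => Mp_le H hs x
    _ = ∑' i : ℤ, ed (i+2) ^ (r+1) * ∫⁻ x, MO Φ (Om S g (ed (i+1))) x ^ (r+1) ∂ν := by
        rw [lintegral_tsum]
        · congr 1; ext i
          rw [← lintegral_const_mul _ ((MO_meas H (Om_open _ _ _)).pow_const _)]
          congr 1; ext x
          rw [ENNReal.mul_rpow_of_nonneg _ _ hs.le]
        · intro i
          exact (((MO_meas H (Om_open _ _ _)).const_mul _).pow_const _).aemeasurable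
    _ ≤ ∑' i : ℤ, (4 ^ (r+1) * C1 * 2 * kk) *
          ∫⁻ x, ed i ^ r * ({z | ed i ≤ z}.indicator id (g x) * S x) := by
        apply ENNReal.tsum_le_tsum
        intro i
        calc _ ≤ ed (i+2) ^ (r+1) * (C1 * kk * ∫⁻ x in Om S g (ed (i+1)), S x) := by
              gcongr
              exact htest k Φ S ν H _ (Om_open _ _ _)
          _ = (4 ^ (r+1) * C1 * kk * ed i ^ r) * (ed i * ∫⁻ x in Om S g (ed (i+1)), S x) := by
              rw [hed, ENNReal.mul_rpow_of_nonneg _ _ hs.le,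
                ENNReal.rpow_add _ _ (ed_ne_zero i) (ed_ne_top i), ENNReal.rpow_one]
              ring
          _ ≤ (4 ^ (r+1) * C1 * kk * ed i ^ r) *
              (2 * ∫⁻ x, {z | ed i ≤ z}.indicator id (g x) * S x) := by
              exact mul_le_mul_right (Om_weak H hg i) _
          _ = _ := by
              rw [lintegral_const_mul _ (hindm i)]
              ring
    _ = (4 ^ (r+1) * C1 * 2 * kk) *
          ∫⁻ x, ∑' i : ℤ, ed i ^ r * ({z | ed i ≤ z}.indicator id (g x) * S x) := by
        rw [ENNReal.tsum_mul_left, lintegral_tsum]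
        intro i
        exact ((hindm i).const_mul _).aemeasurable
    _ ≤ (4 ^ (r+1) * C1 * 2 * kk) * ∫⁻ x, C2 * (g x ^ (r+1) * S x) := by
        gcongr with x
        have : ∀ i : ℤ, ed i ^ r * ({z | ed i ≤ z}.indicator id (g x) * S x) =
            {z : ℝ≥0∞ | ed i ≤ z}.indicator (fun _ => ed i ^ r) (g x) * (g x * S x) := by
          intro i
          by_cases h : ed i ≤ g x
          · rw [indicator_of_mem (by exact h), indicator_of_mem (by exact h)]; rfl
          · rw [indicator_of_notMem (by exact h), indicator_of_notMem (by exact h)]; simp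
        simp_rw [this]
        rw [ENNReal.tsum_mul_right]
        calc _ ≤ C2 * g x ^ r * (g x * S x) := by gcongr; exact hdy _
          _ = _ := by
            rw [ENNReal.rpow_add_of_nonneg _ _ hr.le zero_le_one, ENNReal.rpow_one]; ring
    _ = _ := by
        rw [lintegral_const_mul (f := fun x => g x ^ (r+1) * S x) _ ((hg.pow_const _).mul hS)]
        ring

lemma minor (f : ℝ → ℝ≥0∞) : ∃ F : ℝ → ℝ≥0∞, Measurable F ∧ F ≤ f ∧
    ∀ x y, ∫⁻ t in Ioc x y, f t ≤ ∫⁻ t in Ioc x y, F t := by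
  have hex := fun q : ℚ × ℚ =>
    exists_measurable_le_lintegral_eq (volume.restrict (Ioc (q.1:ℝ) q.2)) f
  choose G hGm hGf hGe using hex
  refine ⟨fun t => ⨆ q, G q t, Measurable.iSup hGm, fun t => iSup_le fun q => hGf q t, ?_⟩
  intro x y
  set ι := {q : ℚ × ℚ // x < q.1 ∧ (q.2:ℝ) < y}
  have hU : Ioo x y = ⋃ q : ι, Ioc (q.1.1:ℝ) q.1.2 := by
    ext z
    simp only [mem_iUnion]
    constructor
    · intro hz
      obtain ⟨a, ha, ha'⟩ := exists_rat_btwn hz.1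
      obtain ⟨b, hb, hb'⟩ := exists_rat_btwn hz.2
      exact ⟨⟨(a, b), ha, hb'⟩, ha', hb.le⟩
    · rintro ⟨⟨⟨a, b⟩, ha, hb⟩, hz⟩
      exact ⟨ha.trans hz.1, lt_of_le_of_lt hz.2 hb⟩
  have hdir : Directed (· ⊆ ·) (fun q : ι => Ioc (q.1.1:ℝ) q.1.2) := by
    rintro ⟨⟨a, b⟩, ha, hb⟩ ⟨⟨a', b'⟩, ha', hb'⟩
    refine ⟨⟨(min a a', max b b'), ?_, ?_⟩, ?_, ?_⟩
    · simp only [Rat.cast_min]; exact lt_min ha ha'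
    · simp only [Rat.cast_max]; exact max_lt hb hb'
    · apply Ioc_subset_Ioc <;> simp
    · apply Ioc_subset_Ioc <;> simp
  have hr : volume.restrict (Ioc x y) = volume.restrict (Ioo x y) :=
    Measure.restrict_congr_set Ioo_ae_eq_Ioc.symm
  rw [hr, hU, setLIntegral_iUnion_of_directed _ hdir]
  apply iSup_le
  intro q
  rw [hGe]
  refine (lintegral_mono fun t => le_iSup (fun q => G q t) q.1).trans ?_
  exact lintegral_mono_set (subset_iUnion (fun q : ι => Ioc (q.1.1:ℝ) q.1.2) q)

lemma frac_bound {r k : ℝ} {Φ : ℝ → ℝ} {S : ℝ → ℝ≥0∞} {ν : Measure ℝ} (H : Setup r k Φ S ν)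
    {p q α : ℝ} (hα : 0 < α) (hα1 : α < 1) (hp : 0 < p) (hq0 : 0 < q)
    (hq : 1 / p - 1 / q - α = 0)
    (f : ℝ → ℝ) {g : ℝ → ℝ≥0∞} (hg : Measurable g)
    (hf : ∀ x y, ∫⁻ t in Ioc x y, ENNReal.ofReal |f t| ≤ ∫⁻ t in Ioc x y, g t * S t) (x : ℝ) :
    MplusAlpha α f x ≤ (∫⁻ t, g t ^ p * S t) ^ α *
      Mp (fun t => g t ^ (p / (q * (1 - α))) * S t) x ^ (1 - α) := by
  have hS := H.hS
  have h1α : 0 < 1 - α := by linarith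
  apply iSup₂_le
  intro h hh
  have hxh : x < x + h := by linarith
  have hold : ∫⁻ t in Ioc x (x+h), g t * S t ≤
      (∫⁻ t in Ioc x (x+h), g t ^ p * S t) ^ α *
      (∫⁻ t in Ioc x (x+h), g t ^ (p / (q * (1 - α))) * S t) ^ (1 - α) := by
    refine le_trans (le_of_eq ?_) (ENNReal.lintegral_mul_norm_pow_le
      (((hg.pow_const _).mul hS).aemeasurable) (((hg.pow_const _).mul hS).aemeasurable)
      hα.le h1α.le (by ring))
    congr 1; ext t
    simp only [Pi.mul_apply]
    rw [ENNReal.mul_rpow_of_nonneg _ _ hα.le, ENNReal.mul_rpow_of_nonneg _ _ h1α.le,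
      ← ENNReal.rpow_mul, ← ENNReal.rpow_mul]
    have e1 : p / (q * (1 - α)) * (1 - α) = p / q := by field_simp
    have e2 : p * α + p / q = 1 := by
      have : α = 1 / p - 1 / q := by linarith
      rw [this]; field_simp; ring
    rw [e1]
    calc g t * S t = g t ^ (p * α + p / q) * S t ^ (α + (1 - α)) := by
          rw [e2, ENNReal.rpow_one, add_sub_cancel, ENNReal.rpow_one]
      _ = _ := by
          rw [ENNReal.rpow_add_of_nonneg _ _ (by positivity) (by positivity),
            ENNReal.rpow_add_of_nonneg _ _ hα.le h1α.le]
          ring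
  have e3 : ENNReal.ofReal (h ^ (α - 1)) = ENNReal.ofReal h⁻¹ ^ (1 - α) := by
    rw [ENNReal.ofReal_rpow_of_pos (by positivity), Real.inv_rpow hh.le, ← Real.rpow_neg hh.le]
    congr 2; ring
  calc ENNReal.ofReal (h ^ (α - 1)) * ∫⁻ t in Ioc x (x + h), ENNReal.ofReal |f t|
      ≤ ENNReal.ofReal h⁻¹ ^ (1 - α) * ((∫⁻ t in Ioc x (x+h), g t ^ p * S t) ^ α *
      (∫⁻ t in Ioc x (x+h), g t ^ (p / (q * (1 - α))) * S t) ^ (1 - α)) := by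
        rw [e3]; gcongr; exact (hf _ _).trans hold
    _ = (∫⁻ t in Ioc x (x+h), g t ^ p * S t) ^ α *
      (ENNReal.ofReal h⁻¹ * ∫⁻ t in Ioc x (x+h), g t ^ (p / (q * (1 - α))) * S t) ^ (1 - α) := by
        rw [ENNReal.mul_rpow_of_nonneg _ _ h1α.le]; ring
    _ ≤ _ := by
        gcongr
        · exact Measure.restrict_le_self
        · unfold Mp
          refine le_iSup₂_of_le (x+h) hxh ?_
          simp

lemma main_meas (p q α : ℝ) (hα : 0 < α) (hα1 : α < 1) (hp : 1 < p) (hq0 : 0 < q)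
    (hq : 1 / p - 1 / q - α = 0) : ∃ c : ℝ, 0 < c ∧
    ∀ (k : ℝ) (Φ : ℝ → ℝ) (S : ℝ → ℝ≥0∞)
    (ν : Measure ℝ), Setup (q / (p / (p - 1))) k Φ S ν → ∀ (f : ℝ → ℝ) (g : ℝ → ℝ≥0∞),
    Measurable g →
    (∀ x y, ∫⁻ t in Ioc x y, ENNReal.ofReal |f t| ≤ ∫⁻ t in Ioc x y, g t * S t) →
    (∫⁻ x, MplusAlpha α f x ^ q ∂ν) ^ (1 / q) ≤
      ENNReal.ofReal c * ENNReal.ofReal k ^ ((p / (p - 1)) / q * (1 - α)) *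
        (∫⁻ x, g x ^ p * S x) ^ (1 / p) := by
  have hp0 : 0 < p := by linarith
  have hp1 : 0 < p - 1 := by linarith
  have h1α : 0 < 1 - α := by linarith
  set r := q / (p / (p - 1)) with hrdef
  have hr : 0 < r := by positivity
  have hαe : α = 1 / p - 1 / q := by linarith
  have hrq : r + 1 = q * (1 - α) := by
    rw [hrdef, hαe]; field_simp; ring
  obtain ⟨C, hC, hcore⟩ := core hr
  have hCq : C ^ (1/q) ≠ ∞ := ENNReal.rpow_ne_top_of_nonneg (by positivity) hC
  refine ⟨(C ^ (1/q)).toReal + 1, by positivity, ?_⟩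
  intro k Φ S ν H f g hg hf
  have hk := H.hk
  set c := (C ^ (1/q)).toReal + 1 with hc
  have hcpos : 0 < c := by positivity
  have hCc : C ^ (1/q) ≤ ENNReal.ofReal c := by
    rw [ENNReal.le_ofReal_iff_toReal_le hCq hcpos.le, hc]; linarith
  set N := ∫⁻ x, g x ^ p * S x with hN
  by_cases hNt : N = ∞
  · rw [hNt, ENNReal.top_rpow_of_pos (by positivity), ENNReal.mul_top]
    · exact le_top
    · apply mul_ne_zero
      · simpa using hcpos
      · exact (ENNReal.rpow_pos (by simpa using hk) (by simp)).ne'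
  have hNα : (N ^ α) ^ q ≠ ∞ := ENNReal.rpow_ne_top_of_nonneg hq0.le
    (ENNReal.rpow_ne_top_of_nonneg hα.le hNt)
  have h1 : ∫⁻ x, MplusAlpha α f x ^ q ∂ν ≤ (N ^ α) ^ q * (C * ENNReal.ofReal (k ^ (1 + 1 / r)) * N) := by
    calc ∫⁻ x, MplusAlpha α f x ^ q ∂ν
        ≤ ∫⁻ x, (N ^ α) ^ q * Mp (fun t => g t ^ (p / (q * (1 - α))) * S t) x ^ (r + 1) ∂ν := by
          apply lintegral_mono
          intro x
          have := ENNReal.rpow_le_rpow (frac_bound H hα hα1 hp0 hq0 hq f hg hf x) hq0.le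
          rw [ENNReal.mul_rpow_of_nonneg _ _ hq0.le, ← ENNReal.rpow_mul (Mp _ x), mul_comm (1 - α) q,
            ← hrq] at this
          rw [← hrq]
          exact this
      _ = (N ^ α) ^ q * ∫⁻ x, Mp (fun t => g t ^ (p / (q * (1 - α))) * S t) x ^ (r + 1) ∂ν :=
          lintegral_const_mul' _ _ hNα
      _ ≤ _ := by
          refine mul_le_mul_right ?_ _
          refine (hcore k Φ S ν H _ (hg.pow_const _)).trans (le_of_eq ?_)
          congr 1
          rw [hN]; congr 1; ext x
          rw [← ENNReal.rpow_mul, hrq]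
          congr 2; field_simp
  calc _ ≤ ((N ^ α) ^ q * (C * ENNReal.ofReal (k ^ (1 + 1 / r)) * N)) ^ (1/q) := by gcongr
    _ = C ^ (1/q) * ENNReal.ofReal k ^ ((p / (p - 1)) / q * (1 - α)) * N ^ (1 / p) := by
      have hq1 : 0 ≤ 1 / q := by positivity
      rw [ENNReal.mul_rpow_of_nonneg _ _ hq1, ENNReal.mul_rpow_of_nonneg _ _ hq1,
        ENNReal.mul_rpow_of_nonneg _ _ hq1, ← ENNReal.rpow_mul, ← ENNReal.rpow_mul,
        ← ENNReal.ofReal_rpow_of_pos hk, ← ENNReal.rpow_mul]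
      have e1 : (1 + 1 / r) * (1 / q) = (p / (p - 1)) / q * (1 - α) := by
        have : 1 + 1 / r = q * (1 - α) / r := by rw [← hrq]; field_simp
        rw [this, hrdef]; field_simp
      have e2 : 1 / p = α * q * (1 / q) + 1 / q := by
        rw [hαe]; field_simp; ring
      rw [e1, e2, ENNReal.rpow_add_of_nonneg _ _ (by positivity) hq1, mul_assoc α q]
      ring
    _ ≤ _ := by gcongr

lemma lintIoc_pos {v : ℝ → ℝ} (hv : Measurable v) (h0 : ∀ x, 0 < v x) {a b : ℝ} (hab : a < b) :
    lintIoc v a b ≠ 0 := by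
  unfold lintIoc
  refine ne_of_gt ?_
  rw [setLIntegral_pos_iff hv.ennreal_ofReal]
  have : Function.support (fun t => ENNReal.ofReal (v t)) = univ := by
    ext x; simp [h0 x]
  rw [this, univ_inter, Real.volume_Ioc]
  simpa using hab

lemma setup_of {p q : ℝ} (hp : 1 < p) (hq0 : 0 < q) {v : ℝ → ℝ} (hv : Measurable v)
    (h0 : ∀ x, 0 < v x) (hK : apqPlusChar p q v ≠ ∞) :
    Setup (q / (p / (p - 1))) (apqPlusChar p q v).toReal
      (fun x => ∫ t in (0:ℝ)..x, v t ^ (-(p / (p - 1))))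
      (fun x => ENNReal.ofReal (v x ^ (-(p / (p - 1)))))
      (volume.withDensity (fun x => ENNReal.ofReal (v x ^ (-(p / (p - 1)))) ^
        (-(q / (p / (p - 1)))))) := by
  set p' := p / (p - 1) with hp'
  have hp'0 : 0 < p' := by rw [hp']; apply div_pos <;> linarith
  set r := q / p' with hr
  have hr0 : 0 < r := by positivity
  set K := apqPlusChar p q v with hKd
  have hm1 : Measurable (fun t => v t ^ q) := hv.pow_const _
  have hm2 : Measurable (fun t => v t ^ (-p')) := hv.pow_const _
  have hp1 : ∀ t, 0 < v t ^ q := fun t => Real.rpow_pos_of_pos (h0 t) _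
  have hp2 : ∀ t, 0 < v t ^ (-p') := fun t => Real.rpow_pos_of_pos (h0 t) _
  have hle : ∀ x h, 0 < h → avgIoc (fun t => v t ^ q) (x - h) x *
      avgIoc (fun t => v t ^ (-p')) x (x + h) ^ r ≤ K := by
    intro x h hh
    rw [hKd]; unfold apqPlusChar
    exact le_iSup_of_le x (le_iSup_of_le h (le_iSup_of_le hh le_rfl))
  have ha1 : ∀ a b, a < b → avgIoc (fun t => v t ^ q) a b ≠ 0 := by
    intro a b hab
    unfold avgIoc
    exact mul_ne_zero (by simp) (lintIoc_pos hm1 hp1 hab)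
  have ha2 : ∀ a b, a < b → avgIoc (fun t => v t ^ (-p')) a b ≠ 0 := by
    intro a b hab
    unfold avgIoc
    exact mul_ne_zero (by simp) (lintIoc_pos hm2 hp2 hab)
  have hfin : ∀ a b, a < b → lintIoc (fun t => v t ^ (-p')) a b ≠ ∞ := by
    intro a b hab htop
    have h1 := hle a (b - a) (by linarith)
    have e : a + (b - a) = b := by ring
    rw [e] at h1
    have : avgIoc (fun t => v t ^ (-p')) a b = ∞ := by
      unfold avgIoc
      rw [htop, ENNReal.mul_top (by simp)]
    rw [this, ENNReal.top_rpow_of_pos hr0, ENNReal.mul_top (ha1 _ _ (by linarith))] at h1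
    exact hK (top_le_iff.mp h1)
  have hint : ∀ a b, IntervalIntegrable (fun t => v t ^ (-p')) volume a b := by
    have key : ∀ a b, a ≤ b → IntervalIntegrable (fun t => v t ^ (-p')) volume a b := by
      intro a b hab
      rw [intervalIntegrable_iff_integrableOn_Ioc_of_le hab]
      rcases hab.eq_or_lt with rfl | hab
      · simp
      refine ⟨hm2.aestronglyMeasurable, ?_⟩
      rw [hasFiniteIntegral_iff_ofReal (Eventually.of_forall fun t => (hp2 t).le)]
      exact lt_top_iff_ne_top.mpr (hfin a b hab)
    intro a b
    rcases le_total a b with h | h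
    · exact key a b h
    · exact (key b a h).symm
  have hdiff : ∀ a b, (∫ t in (0:ℝ)..b, v t ^ (-p')) - (∫ t in (0:ℝ)..a, v t ^ (-p')) =
      ∫ t in a..b, v t ^ (-p') := fun a b =>
    intervalIntegral.integral_interval_sub_left (hint _ _) (hint _ _)
  have hμ : ∀ a b, a ≤ b → ∫⁻ x in Ioc a b, ENNReal.ofReal (v x ^ (-p')) =
      ENNReal.ofReal ((∫ t in (0:ℝ)..b, v t ^ (-p')) - (∫ t in (0:ℝ)..a, v t ^ (-p'))) := by
    intro a b hab
    rw [hdiff, intervalIntegral.integral_of_le hab, ofReal_integral_eq_lintegral_ofReal]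
    · exact (intervalIntegrable_iff_integrableOn_Ioc_of_le hab).mp (hint a b)
    · exact Eventually.of_forall fun t => (hp2 t).le
  have hKpos : 0 < K := by
    refine lt_of_lt_of_le ?_ (hle 0 1 one_pos)
    refine pos_iff_ne_zero.mpr (mul_ne_zero (ha1 _ _ (by norm_num)) ?_)
    intro h
    rw [ENNReal.rpow_eq_zero_iff_of_pos hr0] at h
    exact ha2 _ _ (by norm_num) h
  have hmono : StrictMono (fun x => ∫ t in (0:ℝ)..x, v t ^ (-p')) := by
    intro a b hab
    have h1 := hμ a b hab.le
    have h2 := lintIoc_pos hm2 hp2 hab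
    unfold lintIoc at h2
    rw [h1] at h2
    have := ENNReal.ofReal_pos.mp (pos_iff_ne_zero.mpr h2)
    simpa using this
  have hden : ∀ x, ENNReal.ofReal (v x ^ (-p')) ^ (-r) = ENNReal.ofReal (v x ^ q) := by
    intro x
    rw [ENNReal.ofReal_rpow_of_pos (hp2 x), ← Real.rpow_mul (h0 x).le]
    congr 2; rw [hr]; field_simp
  refine ⟨hr0, ENNReal.toReal_pos hKpos.ne' hK,
    intervalIntegral.continuous_primitive hint 0, hmono, hm2.ennreal_ofReal,
    fun x => by simpa using hp2 x, fun x => ENNReal.ofReal_ne_top, hμ, rfl, ?_⟩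
  intro a b c hab hbc
  have hh : 0 < c - a := by linarith
  have h1 := hle b (c - a) hh
  have hΦ0 : 0 < (∫ t in (0:ℝ)..c, v t ^ (-p')) - (∫ t in (0:ℝ)..b, v t ^ (-p')) :=
    sub_pos.mpr (hmono hbc)
  rw [withDensity_apply _ measurableSet_Ioc]
  simp only [hden]
  rw [← ENNReal.ofReal_rpow_of_pos hΦ0, ← hμ b c hbc.le, ENNReal.ofReal_mul ENNReal.toReal_nonneg,
    ENNReal.ofReal_toReal hK, ← ENNReal.ofReal_rpow_of_pos hh]
  set H := ENNReal.ofReal (c - a) with hH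
  have hH0 : H ≠ 0 := by rw [hH]; simpa using hh
  have hHt : H ≠ ∞ := ENNReal.ofReal_ne_top
  have i1 : ∫⁻ x in Ioc a b, ENNReal.ofReal (v x ^ q) ≤
      H * avgIoc (fun t => v t ^ q) (b - (c - a)) b := by
    unfold avgIoc lintIoc
    rw [show b - (b - (c - a)) = c - a by ring, ← hH, ← mul_assoc, ENNReal.mul_inv_cancel hH0 hHt,
      one_mul]
    exact lintegral_mono_set (Ioc_subset_Ioc_left (by linarith))
  have i2 : ∫⁻ x in Ioc b c, ENNReal.ofReal (v x ^ (-p')) ≤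
      H * avgIoc (fun t => v t ^ (-p')) b (b + (c - a)) := by
    unfold avgIoc lintIoc
    rw [show b + (c - a) - b = c - a by ring, ← hH, ← mul_assoc, ENNReal.mul_inv_cancel hH0 hHt,
      one_mul]
    exact lintegral_mono_set (Ioc_subset_Ioc_right (by linarith))
  calc _ ≤ (H * avgIoc (fun t => v t ^ q) (b - (c - a)) b) *
        (H * avgIoc (fun t => v t ^ (-p')) b (b + (c - a))) ^ r := by gcongr
    _ = (avgIoc (fun t => v t ^ q) (b - (c - a)) b *
        avgIoc (fun t => v t ^ (-p')) b (b + (c - a)) ^ r) * H ^ (r + 1) := by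
      rw [ENNReal.mul_rpow_of_nonneg _ _ hr0.le, ENNReal.rpow_add _ _ hH0 hHt, ENNReal.rpow_one]
      ring
    _ ≤ _ := by gcongr

lemma lintIoc_congr {u v : ℝ → ℝ} (h : u =ᵐ[volume] v) (a b : ℝ) : lintIoc u a b = lintIoc v a b := by
  unfold lintIoc
  refine lintegral_congr_ae (ae_restrict_of_ae ?_)
  filter_upwards [h] with x hx
  rw [hx]

lemma apq_congr {p q : ℝ} {u v : ℝ → ℝ} (h : u =ᵐ[volume] v) :
    apqPlusChar p q u = apqPlusChar p q v := by
  have e : ∀ s : ℝ, (fun t => u t ^ s) =ᵐ[volume] (fun t => v t ^ s) := by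
    intro s
    filter_upwards [h] with x hx
    rw [hx]
  unfold apqPlusChar avgIoc
  simp only [lintIoc_congr (e _)]

lemma lnormW_congr {p : ℝ} {u v : ℝ → ℝ} (h : u =ᵐ[volume] v) (g : ℝ → ℝ≥0∞) :
    lnormW p (fun x => u x ^ p) g = lnormW p (fun x => v x ^ p) g := by
  unfold lnormW
  congr 1
  refine lintegral_congr_ae ?_
  filter_upwards [h] with x hx
  rw [hx]

/-- Sharp one-weight bound for `M⁺_α`:
`‖w M⁺_α f‖_{L^q} ≤ c ‖w‖_{A_{p,q}^+}^{(p'/q)(1-α)} ‖wf‖_{L^p}`, i.e.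
`‖M⁺_α‖_{L^p_{w^p} → L^q_{w^q}} ≤ c ‖w‖_{A_{p,q}^+}^{(p'/q)(1-α)}`. -/
theorem stmt8 (p q α : ℝ) (hα : 0 < α) (hα1 : α < 1) (hp : 1 < p) (hpα : p < 1 / α)
    (hq : 1 / p - 1 / q - α = 0) :
    ∃ c : ℝ, 0 < c ∧
      ∀ w : ℝ → ℝ, IsWeight w → apqPlusChar p q w ≠ ∞ →
        ∀ f : ℝ → ℝ,
          lnormW q (fun x => w x ^ q) (MplusAlpha α f) ≤
            ENNReal.ofReal c * apqPlusChar p q w ^ ((p / (p - 1)) / q * (1 - α)) *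
              lnormW p (fun x => w x ^ p) (fun x => ENNReal.ofReal |f x|) := by
  have hq0 : 0 < q := by
    have h1 : α < 1 / p := by
      rw [lt_div_iff₀ (by linarith)]
      rw [lt_div_iff₀ hα] at hpα
      linarith
    have h2 : 0 < 1 / q := by linarith
    exact one_div_pos.mp h2
  obtain ⟨c, hc, hmain⟩ := main_meas p q α hα hα1 hp hq0 hq
  refine ⟨c, hc, ?_⟩
  intro w hw hK f
  obtain ⟨v, hv, h0, hwv⟩ : ∃ v : ℝ → ℝ, Measurable v ∧ (∀ x, 0 < v x) ∧ w =ᵐ[volume] v := by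
    have hae := hw.2.aestronglyMeasurable.aemeasurable
    refine ⟨fun x => if 0 < hae.mk w x then hae.mk w x else 1, ?_, ?_, ?_⟩
    · exact Measurable.ite (measurableSet_lt measurable_const hae.measurable_mk)
        hae.measurable_mk measurable_const
    · intro x
      dsimp only
      split_ifs with h
      · exact h
      · exact one_pos
    · filter_upwards [hae.ae_eq_mk, hw.1] with x hx hx0
      rw [← hx, if_pos hx0]
  rw [apq_congr hwv] at hK ⊢
  rw [lnormW_congr hwv, lnormW_congr hwv]
  have H := setup_of hp hq0 hv h0 hK
  obtain ⟨F, hF, hFf, hFi⟩ := minor (fun t => ENNReal.ofReal |f t|)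
  have hS0 := H.hS0
  have hSt := H.hSt
  have hm := hmain _ _ _ _ H f
    (fun x => F x / ENNReal.ofReal (v x ^ (-(p / (p - 1))))) (hF.div H.hS) (by
      intro x y
      refine (hFi x y).trans (le_of_eq ?_)
      congr 1; ext t
      exact (ENNReal.div_mul_cancel (hS0 t) (hSt t)).symm)
  rw [ENNReal.ofReal_toReal hK] at hm
  have hp2 : ∀ t, 0 < v t ^ (-(p / (p - 1))) := fun t => Real.rpow_pos_of_pos (h0 t) _
  have hpm : p - 1 ≠ 0 := by linarith
  have hden : ∀ x, ENNReal.ofReal (v x ^ (-(p / (p - 1)))) ^ (-(q / (p / (p - 1)))) =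
      ENNReal.ofReal (v x ^ q) := by
    intro x
    rw [ENNReal.ofReal_rpow_of_pos (hp2 x), ← Real.rpow_mul (h0 x).le]
    congr 2; field_simp
  have hL : lnormW q (fun x => v x ^ q) (MplusAlpha α f) =
      (∫⁻ x, MplusAlpha α f x ^ q ∂(volume.withDensity
        (fun x => ENNReal.ofReal (v x ^ (-(p / (p - 1)))) ^ (-(q / (p / (p - 1))))))) ^ (1 / q) := by
    unfold lnormW
    simp only [hden]
    congr 1
    rw [lintegral_withDensity_eq_lintegral_mul_non_measurable _ (hv.pow_const q).ennreal_ofReal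
      (Eventually.of_forall fun x => ENNReal.ofReal_lt_top)]
    congr 1; ext x
    simp only [Pi.mul_apply]
    rw [mul_comm]
  rw [hL]
  refine hm.trans ?_
  refine mul_le_mul_right ?_ _
  unfold lnormW
  refine ENNReal.rpow_le_rpow (lintegral_mono ?_) (by positivity)
  intro x
  dsimp only
  rw [ENNReal.div_eq_inv_mul, ENNReal.mul_rpow_of_nonneg _ _ (by linarith), mul_right_comm, mul_comm]
  refine mul_le_mul' (ENNReal.rpow_le_rpow (hFf x) (by linarith)) (le_of_eq ?_)
  rw [← ENNReal.ofReal_inv_of_pos (hp2 x), ENNReal.ofReal_rpow_of_pos (inv_pos.mpr (hp2 x)),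
    ← ENNReal.ofReal_mul (by have := hp2 x; positivity), ← Real.rpow_neg (h0 x).le,
    ← Real.rpow_mul (h0 x).le, ← Real.rpow_add (h0 x)]
  congr 2; field_simp; ring

end
end
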